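/- For every integer g ≥ 0, every graph with Euler genus g is contained in H ⊠ P ⊠ K_{max{2g,3}} for some apex graph H with treewidth at most 4 and for some path P. -/

import Mathlib

/-!
Common definitions: multigraphs, combinatorial (cellular) surface embeddings,
Euler genus, framed graphs, strong products, treewidth, partitions and layerings.
-/

/-- A multigraph on vertex type `V` with edge type `E`, given by its endpoints map. -/
structure Multigraph (V E : Type) where
  ends : E → Sym2 V

namespace Multigraph

variable {V E F : Type}

/-- The simple graph underlying a multigraph. -/
def simple (G : Multigraph V E) : SimpleGraph V where
  Adj u v := u ≠ v ∧ ∃ e, G.ends e = s(u, v)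
  symm := by
    constructor
    rintro u v ⟨hne, e, he⟩
    exact ⟨hne.symm, e, he.trans Sym2.eq_swap⟩
  loopless := by constructor; rintro u ⟨hne, -⟩; exact hne rfl

/-- The simple graph on `V` whose edges are the edges of `G` lying in `S`. -/
def simpleOn (G : Multigraph V E) (S : Set E) : SimpleGraph V where
  Adj u v := u ≠ v ∧ ∃ e ∈ S, G.ends e = s(u, v)
  symm := by
    constructor
    rintro u v ⟨hne, e, heS, he⟩
    exact ⟨hne.symm, e, heS, he.trans Sym2.eq_swap⟩
  loopless := by constructor; rintro u ⟨hne, -⟩; exact hne rfl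

/-- A multigraph is simple: no loops and no parallel edges. -/
def IsSimple (G : Multigraph V E) : Prop :=
  (∀ e, ¬ (G.ends e).IsDiag) ∧ Function.Injective G.ends

/-- A set `S` of edges of `G` forms a spanning tree of `G`. -/
def IsSpanningTree (G : Multigraph V E) (S : Set E) : Prop :=
  (G.simpleOn S).IsTree ∧ (∀ e ∈ S, ¬ (G.ends e).IsDiag) ∧
    ∀ e ∈ S, ∀ e' ∈ S, G.ends e = G.ends e' → e = e'

/-- A closed walk in a multigraph, recorded as periodic sequences of vertices and
edges: the walk visits `vtx 0, vtx 1, …, vtx (len - 1)` and returns to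
`vtx len = vtx 0`, traversing the edge `edge i` between `vtx i` and `vtx (i+1)`. -/
structure CWalk (G : Multigraph V E) where
  len : ℕ
  len_pos : 0 < len
  vtx : ℕ → V
  edge : ℕ → E
  vtx_per : ∀ i, vtx (i + len) = vtx i
  edge_per : ∀ i, edge (i + len) = edge i
  compat : ∀ i, G.ends (edge i) = s(vtx i, vtx (i + 1))

namespace CWalk

variable {G : Multigraph V E}

/-- The vertex `v` lies on the closed walk `W`. -/
def HasVtx (W : G.CWalk) (v : V) : Prop := ∃ i, i < W.len ∧ W.vtx i = v

/-- The edge `e` lies on the closed walk `W`. -/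
def HasEdge (W : G.CWalk) (e : E) : Prop := ∃ i, i < W.len ∧ W.edge i = e

/-- The closed walk `W` is a cycle: it repeats no vertex and no edge. -/
def IsCycle (W : G.CWalk) : Prop :=
  (∀ i j, i < W.len → j < W.len → W.vtx i = W.vtx j → i = j) ∧
  (∀ i j, i < W.len → j < W.len → W.edge i = W.edge j → i = j)

end CWalk

/-- `p = (f, i)` is an occurrence of the edge `e` in the family `bd` of closed walks:
the walk of face `f` traverses `e` at position `i`. -/
def IsOcc {G : Multigraph V E} (bd : F → G.CWalk) (e : E) (p : F × ℕ) : Prop :=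
  p.2 < (bd p.1).len ∧ (bd p.1).edge p.2 = e

/-- `c = (f, i)` is a corner of the vertex `v`: the walk of face `f` visits `v`
at position `i`. -/
def IsCorner {G : Multigraph V E} (bd : F → G.CWalk) (v : V) (c : F × ℕ) : Prop :=
  c.2 < (bd c.1).len ∧ (bd c.1).vtx c.2 = v

/-- The corner `c` is one of the two end corners of the edge occurrence `p`. -/
def EndOf {G : Multigraph V E} (bd : F → G.CWalk) (c p : F × ℕ) : Prop :=
  c.1 = p.1 ∧ (c.2 = p.2 ∨ c.2 = (p.2 + 1) % (bd p.1).len)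

/-- Two corners of `v` are linked if they are end corners (at `v`) of the two
distinct occurrences of a common edge; this is the edge-to-edge gluing relation
around the vertex `v`. -/
def CornerLinked {G : Multigraph V E} (bd : F → G.CWalk) (v : V) (c c' : F × ℕ) : Prop :=
  IsCorner bd v c ∧ IsCorner bd v c' ∧
    ∃ (e : E) (p p' : F × ℕ), p ≠ p' ∧ IsOcc bd e p ∧ IsOcc bd e p' ∧
      EndOf bd c p ∧ EndOf bd c' p'

/-- A combinatorial (cellular) embedding of a connected multigraph `G` in a closed
surface, with face set `F`: every face is given by its closed boundary walk, every
edge of `G` is traversed exactly twice in total by the boundary walks, and the link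
of every vertex is connected (so the embedding is in a genuine surface, with no
pinch points). -/
structure Embedding (G : Multigraph V E) (F : Type) where
  boundary : F → G.CWalk
  conn : G.simple.Connected
  edge_twice : ∀ e : E, {p : F × ℕ | IsOcc boundary e p}.ncard = 2
  link_conn : ∀ (v : V) (c c' : F × ℕ), IsCorner boundary v c → IsCorner boundary v c' →
    Relation.EqvGen (CornerLinked boundary v) c c'

/-- The Euler genus `2 - (|V| - |E| + |F|)` of an embedding, via Euler's formula. -/
noncomputable def Embedding.eulerGenus {G : Multigraph V E} {F : Type}
    (_ : Embedding G F) : ℤ :=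
  2 - ((Nat.card V : ℤ) - Nat.card E + Nat.card F)

/-- The simple graph underlying the framed multigraph `G^{(d)}`: two distinct
vertices are adjacent iff they are joined by an edge of `G` or lie on a common
face of length at most `d` (in which case `G^{(d)}` has a chord between them). -/
def framedGraph {G : Multigraph V E} {F : Type} (emb : Embedding G F) (d : ℕ) :
    SimpleGraph V where
  Adj u v := u ≠ v ∧ ((∃ e, G.ends e = s(u, v)) ∨
    ∃ f, (emb.boundary f).len ≤ d ∧ (emb.boundary f).HasVtx u ∧ (emb.boundary f).HasVtx v)
  symm := by
    constructor
    rintro u v ⟨hne, (⟨e, he⟩ | ⟨f, h1, h2, h3⟩)⟩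
    · exact ⟨hne.symm, Or.inl ⟨e, he.trans Sym2.eq_swap⟩⟩
    · exact ⟨hne.symm, Or.inr ⟨f, h1, h3, h2⟩⟩
  loopless := by constructor; rintro u ⟨hne, -⟩; exact hne rfl

end Multigraph

namespace SimpleGraph

/-- `G` is contained in `X`: `G` is isomorphic to a subgraph of `X`. -/
def IsContainedIn {α β : Type} (G : SimpleGraph α) (X : SimpleGraph β) : Prop :=
  ∃ f : G →g X, Function.Injective f

/-- The strong product of two simple graphs. -/
def strongProd {α β : Type} (G : SimpleGraph α) (H : SimpleGraph β) :
    SimpleGraph (α × β) where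
  Adj x y := x ≠ y ∧ (x.1 = y.1 ∨ G.Adj x.1 y.1) ∧ (x.2 = y.2 ∨ H.Adj x.2 y.2)
  symm := by
    constructor
    rintro x y ⟨hne, h1, h2⟩
    exact ⟨hne.symm, h1.imp Eq.symm (fun h => G.adj_symm h), h2.imp Eq.symm (fun h => H.adj_symm h)⟩
  loopless := by constructor; rintro x ⟨hne, -⟩; exact hne rfl

end SimpleGraph

/-- `G` has treewidth at most `k`: it has a tree-decomposition with all bags of
size at most `k + 1`. -/
def TreewidthLE {α : Type} (G : SimpleGraph α) (k : ℕ) : Prop :=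
  ∃ (ι : Type) (T : SimpleGraph ι) (B : ι → Set α),
    T.IsTree ∧
    (∀ v, ∃ i, v ∈ B i) ∧
    (∀ u v, G.Adj u v → ∃ i, u ∈ B i ∧ v ∈ B i) ∧
    (∀ v, (T.induce {i | v ∈ B i}).Connected) ∧
    ∀ i, (B i).encard ≤ (k : ℕ∞) + 1

/-- `G` has Euler genus at most `g`: `G` is (isomorphic to) a subgraph of a
multigraph having a combinatorial embedding of Euler genus at most `g`. -/
def HasEulerGenusLE {α : Type} (G : SimpleGraph α) (g : ℕ) : Prop :=
  ∃ (V' E' F' : Type), Finite V' ∧ Finite E' ∧ Finite F' ∧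
    ∃ (M : Multigraph V' E') (emb : M.Embedding F'),
      emb.eulerGenus ≤ (g : ℤ) ∧ G.IsContainedIn M.simple

/-- A planar graph: a graph of Euler genus `0`. -/
def IsPlanar {α : Type} (G : SimpleGraph α) : Prop := HasEulerGenusLE G 0

/-- An apex graph: deleting some vertex leaves a planar graph. -/
def IsApex {α : Type} (G : SimpleGraph α) : Prop :=
  ∃ v : α, IsPlanar (G.induce {w | w ≠ v})

/-- `A` indexes a partition of the vertices of `G` into nonempty parts `A x`, and the
quotient of `G` by this partition is (isomorphic to) `H`, via the indexing: this is an
`H`-partition of `G`. -/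
def IsHPartition {α W : Type} (G : SimpleGraph α) (H : SimpleGraph W) (A : W → Set α) : Prop :=
  (∀ x, (A x).Nonempty) ∧ (∀ v, ∃! x, v ∈ A x) ∧
    ∀ x y, x ≠ y → (H.Adj x y ↔ ∃ u ∈ A x, ∃ v ∈ A y, G.Adj u v)

/-- `(L 0, L 1, …)` is a layering of `G`: an ordered partition of the vertices such
that every edge joins vertices in the same or in consecutive layers. -/
def IsLayering {α : Type} (G : SimpleGraph α) (L : ℕ → Set α) : Prop :=
  (∀ v, ∃! j, v ∈ L j) ∧
    ∀ u v, G.Adj u v → ∀ i j, u ∈ L i → v ∈ L j → i ≤ j + 1 ∧ j ≤ i + 1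

/-- `b` lies on every walk from `a` to `c` in `T` (for a tree: `b` is on the unique
`a`–`c` path). -/
def BtwIn {α : Type} (T : SimpleGraph α) (a b c : α) : Prop :=
  ∀ p : T.Walk a c, b ∈ p.support

/-- `Q` is the vertex set of a vertical path in the tree `T` rooted at `r` with upper
end `w` and lower end `u`: `w` lies on the path from `r` to `u`, and `Q` is the set of
vertices of the `w`–`u` path. -/
def IsVerticalPathBtw {α : Type} (T : SimpleGraph α) (r : α) (Q : Set α) (w u : α) : Prop :=
  BtwIn T r w u ∧ Q = {x | BtwIn T w x u}

/-- `Q` is the vertex set of a vertical path in the tree `T` rooted at `r`. -/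
def IsVerticalPath {α : Type} (T : SimpleGraph α) (r : α) (Q : Set α) : Prop :=
  ∃ w u, IsVerticalPathBtw T r Q w u

/-- `Y` is the union of at most `k` vertical paths in the tree `T` rooted at `r`. -/
def IsUnionOfVPaths {α : Type} (T : SimpleGraph α) (r : α) (k : ℕ) (Y : Set α) : Prop :=
  ∃ m, m ≤ k ∧ ∃ Q : Fin m → Set α, (∀ i, IsVerticalPath T r (Q i)) ∧ Y = ⋃ i, Q i


namespace GPS

abbrev W := Fin 3 ⊕ List (Fin 3)

/-- corners of the face with a given address -/
def crn : List (Fin 3) → Fin 3 → W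
  | [], i => Sum.inl i
  | (k :: α), i => if i = k then Sum.inr α else crn α i

def HR (x y : W) : Prop :=
  ∃ α i, (x = Sum.inr α ∧ y = crn α i) ∨ (y = Sum.inr α ∧ x = crn α i)

theorem HR.symm {x y : W} (h : HR x y) : HR y x := by
  obtain ⟨α, i, h | h⟩ := h
  · exact ⟨α, i, Or.inr h⟩
  · exact ⟨α, i, Or.inl h⟩

def ok (n : ℕ) : W → Prop
  | Sum.inl _ => True
  | Sum.inr α => α.length < n

def HG (n : ℕ) : SimpleGraph {w : W // ok n w} where
  Adj x y := x ≠ y ∧ HR x.1 y.1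
  symm := by constructor; rintro x y ⟨h, h'⟩; exact ⟨h.symm, h'.symm⟩
  loopless := by constructor; rintro u ⟨hne, -⟩; exact hne rfl

def LT : SimpleGraph (List (Fin 3)) where
  Adj x y := (∃ k, y = k :: x) ∨ (∃ k, x = k :: y)
  symm := by constructor; rintro x y h; exact h.symm
  loopless := by
    constructor
    rintro u (⟨k, h⟩ | ⟨k, h⟩)
    · exact absurd (congrArg List.length h) (by simp)
    · exact absurd (congrArg List.length h) (by simp)

theorem LT_reach (x : List (Fin 3)) : LT.Reachable x [] := by
  induction x with
  | nil => exact SimpleGraph.Reachable.refl _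
  | cons k x ih =>
    refine SimpleGraph.Reachable.trans (SimpleGraph.Adj.reachable ?_) ih
    exact Or.inr ⟨k, rfl⟩

theorem LT_tree : LT.IsTree := by
  refine ⟨⟨fun x y => (LT_reach x).trans (LT_reach y).symm⟩, ?_⟩
  rw [SimpleGraph.isAcyclic_iff_forall_adj_isBridge]
  have key : ∀ (x : List (Fin 3)) (k : Fin 3), LT.IsBridge s(x, k :: x) := by
    intro x k
    rw [SimpleGraph.isBridge_iff]
    intro hr
    have inv : ∀ a b, (LT.deleteEdges {s(x, k :: x)}).Reachable a b →
        ((k :: x) <:+ a ↔ (k :: x) <:+ b) := by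
      rintro a b ⟨w⟩
      induction w with
      | nil => rfl
      | cons h w ih =>
        refine Iff.trans ?_ ih
        rw [SimpleGraph.deleteEdges_adj] at h
        obtain ⟨h1, h2⟩ := h
        rcases h1 with ⟨c, rfl⟩ | ⟨c, rfl⟩
        · rw [List.suffix_cons_iff]
          constructor
          · exact Or.inr
          · rintro (h | h)
            · rw [List.cons.injEq] at h
              obtain ⟨rfl, rfl⟩ := h
              exact absurd rfl h2
            · exact h
        · rw [List.suffix_cons_iff]
          constructor
          · rintro (h | h)
            · rw [List.cons.injEq] at h
              obtain ⟨rfl, rfl⟩ := h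
              exact absurd Sym2.eq_swap h2
            · exact h
          · exact Or.inr
    have := (inv _ _ hr).2 (List.suffix_refl _)
    have := this.length_le
    simp at this
  rintro v w (⟨k, rfl⟩ | ⟨k, rfl⟩)
  · exact key _ _
  · rw [Sym2.eq_swap]; exact key _ _

theorem crn_nil_mem (α : List (Fin 3)) (γ : List (Fin 3)) (i : Fin 3)
    (h : crn α i = Sum.inr γ) : ∃ k β, α = k :: β ∧ (γ = β ∨ ∃ j, crn β j = Sum.inr γ) := by
  cases α with
  | nil => simp [crn] at h
  | cons k β =>
    refine ⟨k, β, rfl, ?_⟩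
    simp only [crn] at h
    split_ifs at h
    · left; simpa using h.symm
    · right; exact ⟨i, h⟩

theorem tw_HG (n : ℕ) : TreewidthLE (HG n) 4 := by
  refine ⟨List (Fin 3), LT, fun α => {w | w.1 = Sum.inr α ∨ ∃ i, w.1 = crn α i}, LT_tree,
    ?_, ?_, ?_, ?_⟩
  · rintro ⟨(i | α), h⟩
    · exact ⟨[], Or.inr ⟨i, rfl⟩⟩
    · exact ⟨α, Or.inl rfl⟩
  · rintro u v ⟨-, α, i, h | h⟩
    · exact ⟨α, Or.inl h.1, Or.inr ⟨i, h.2⟩⟩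
    · exact ⟨α, Or.inr ⟨i, h.2⟩, Or.inl h.1⟩
  · rintro ⟨v, hv⟩
    -- there is a root and every element has its tail in the set, or is the root
    have gen : ∀ (s : Set (List (Fin 3))) (r : List (Fin 3)) (hr : r ∈ s),
        (∀ α ∈ s, α = r ∨ ∃ k β, α = k :: β ∧ β ∈ s) → (LT.induce s).Connected := by
      intro s r hr hs
      have hre : ∀ α (h : α ∈ s), (LT.induce s).Reachable ⟨α, h⟩ ⟨r, hr⟩ := by
        intro α
        induction α with
        | nil =>
          intro h
          rcases hs _ h with rfl | ⟨k, β, h1, -⟩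
          · exact SimpleGraph.Reachable.refl _
          · simp at h1
        | cons k α ih =>
          intro h
          rcases hs _ h with rfl | ⟨k', β, h1, h2⟩
          · exact SimpleGraph.Reachable.refl _
          · rw [List.cons.injEq] at h1
            obtain ⟨rfl, rfl⟩ := h1
            refine SimpleGraph.Reachable.trans (SimpleGraph.Adj.reachable ?_) (ih h2)
            exact Or.inr ⟨k, rfl⟩
      haveI : Nonempty s := ⟨⟨r, hr⟩⟩
      exact ⟨fun x y => (hre x.1 x.2).trans (hre y.1 y.2).symm⟩
    rcases v with i | γ
    · refine gen _ [] (Or.inr ⟨i, rfl⟩) ?_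
      rintro α (h | ⟨j, h⟩)
      · simp at h
      · cases α with
        | nil => exact Or.inl rfl
        | cons k β =>
          right
          refine ⟨k, β, rfl, Or.inr ⟨j, ?_⟩⟩
          simp only [crn] at h
          split_ifs at h
          exact h
    · refine gen _ γ (Or.inl rfl) ?_
      rintro α (h | ⟨j, h⟩)
      · left; simpa using h.symm
      · right
        obtain ⟨k, β, rfl, h'⟩ := crn_nil_mem _ _ _ h.symm
        refine ⟨k, β, rfl, ?_⟩
        rcases h' with rfl | ⟨j, h'⟩
        · exact Or.inl rfl
        · exact Or.inr ⟨j, h'.symm⟩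
  · intro α
    have hsub : (Subtype.val '' {w : {w : W // ok n w} | w.1 = Sum.inr α ∨ ∃ i, w.1 = crn α i})
        ⊆ ({Sum.inr α, crn α 0, crn α 1, crn α 2} : Set W) := by
      rintro _ ⟨w, h | ⟨i, h⟩, rfl⟩
      · simp [h]
      · rw [h]; fin_cases i <;> simp
    have h1 := Set.encard_le_encard hsub
    rw [Function.Injective.encard_image Subtype.val_injective] at h1
    refine h1.trans ?_
    refine (Set.encard_insert_le _ _).trans ?_
    refine (add_le_add_left (Set.encard_insert_le _ _) 1).trans ?_
    refine (add_le_add_left (add_le_add_left (Set.encard_insert_le _ _) 1) 1).trans ?_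
    rw [Set.encard_singleton]
    norm_num
end GPS


namespace GPS

structure Tri (V E F : Type) where
  v : F → Fin 3 → V
  e : F → Fin 3 → E
  ends : E → Sym2 V
  hends : ∀ f i, ends (e f i) = s(v f i, v f (i+1))
  two : ∀ x, ∃ p q : F × Fin 3, p ≠ q ∧ ∀ r : F × Fin 3, e r.1 r.2 = x ↔ r = p ∨ r = q
  conn : ∀ (P : V → Prop), (∀ x a b, ends x = s(a, b) → P a → P b) → ∀ a b, P a → P b
  link : ∀ (x : V) (P : F × Fin 3 → Prop),
    (∀ c c' p p' : F × Fin 3, v c.1 c.2 = x → v c'.1 c'.2 = x → p ≠ p' → e p.1 p.2 = e p'.1 p'.2 →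
      (c = p ∨ c = (p.1, p.2 + 1)) → (c' = p' ∨ c' = (p'.1, p'.2 + 1)) → P c → P c') →
    ∀ c c' : F × Fin 3, v c.1 c.2 = x → v c'.1 c'.2 = x → P c → P c'

theorem f3a (a b : Fin 3) : b = a ∨ b = a + 1 ∨ b = a + 1 + 1 := by revert a b; decide
theorem f3b (a : Fin 3) : a = a + 2 + 1 := by revert a; decide
theorem f3c (i k : Fin 3) (h : i ≠ k) : k = i + 1 ∨ k = i + 2 := by revert i k; decide
theorem f3d (j : Fin 3) : ¬j + 2 = j + 2 + 1 := by revert j; decide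
theorem f3e (j : Fin 3) : ¬j = j + 1 + 1 := by revert j; decide
theorem f3f (j : Fin 3) : ¬j = j + 1 := by revert j; decide

namespace Tri

variable {V E F : Type}

def base : Tri (Fin 3) (Fin 3) (Fin 2) where
  v _ i := i
  e _ i := i
  ends i := s(i, i + 1)
  hends _ _ := rfl
  two x := ⟨(0, x), (1, x), by simp, by
    rintro ⟨f, i⟩
    fin_cases f <;> simp⟩
  conn P h a b ha := by
    have h1 : ∀ a, P a → P (a + 1) := fun a => h a a (a + 1) rfl
    have h2 := h1 _ ha
    have h3 := h1 _ h2
    have : b = a ∨ b = a + 1 ∨ b = a + 1 + 1 := f3a a b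
    rcases this with rfl | rfl | rfl <;> assumption
  link x P h c c' hc hc' hP := by
    obtain ⟨f, i⟩ := c
    obtain ⟨f', i'⟩ := c'
    simp only at hc hc'
    subst hc
    subst hc'
    by_cases hf : f = f'
    · subst hf; exact hP
    · refine h _ _ (f, i') (f', i') rfl rfl ?_ rfl (Or.inl rfl) (Or.inl rfl) hP
      simpa using hf

def sv (T : Tri V E F) (f : F × Fin 3) (i : Fin 3) : V ⊕ F :=
  if i = f.2 then Sum.inr f.1 else Sum.inl (T.v f.1 i)

def se (T : Tri V E F) (f : F × Fin 3) (i : Fin 3) : E ⊕ (F × Fin 3) :=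
  if i = f.2 + 1 then Sum.inl (T.e f.1 i) else if i = f.2 then Sum.inr (f.1, f.2 + 1)
  else Sum.inr (f.1, f.2 + 2)

theorem se1 (T : Tri V E F) (f : F) (j : Fin 3) : T.se (f, j + 2) j = Sum.inl (T.e f j) := by
  unfold se
  rw [if_pos (f3b j)]

theorem se2 (T : Tri V E F) (f : F) (j : Fin 3) : T.se (f, j + 2) (j + 2) = Sum.inr (f, j) := by
  unfold se
  rw [if_neg (f3d j), if_pos rfl]
  simp only [Sum.inr.injEq, Prod.mk.injEq, true_and]
  revert j; decide

theorem se3 (T : Tri V E F) (f : F) (j : Fin 3) : T.se (f, j + 1) j = Sum.inr (f, j) := by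
  unfold se
  rw [if_neg (f3e j), if_neg (f3f j)]
  simp only [Sum.inr.injEq, Prod.mk.injEq, true_and]
  revert j; decide

theorem sv1 (T : Tri V E F) (f : F) (j : Fin 3) : T.sv (f, j) j = Sum.inr f := by
  simp [sv]

theorem sv2 (T : Tri V E F) (f : F) (j k : Fin 3) (h : j ≠ k) :
    T.sv (f, k) j = Sum.inl (T.v f j) := by
  simp [sv, h]

def send (T : Tri V E F) : E ⊕ (F × Fin 3) → Sym2 (V ⊕ F)
  | Sum.inl x => (T.ends x).map Sum.inl
  | Sum.inr p => s(Sum.inl (T.v p.1 p.2), Sum.inr p.1)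

theorem cases3 (k i : Fin 3) : k = i + 2 ∨ (∃ j, k = j + 2 ∧ i = j + 2) ∨ k = i + 1 := by
  revert k i; decide

def stack (T : Tri V E F) : Tri (V ⊕ F) (E ⊕ (F × Fin 3)) (F × Fin 3) where
  v := T.sv
  e := T.se
  ends := T.send
  hends := by
    rintro ⟨f, k⟩ i
    rcases cases3 k i with rfl | ⟨j, rfl, rfl⟩ | rfl
    · rw [se1, sv2 _ _ _ _ (by revert i; decide), sv2 _ _ _ _ (by revert i; decide)]
      simp [send, T.hends]
    · rw [se2, sv1, sv2 _ _ _ _ (by revert j; decide)]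
      have : j + 2 + 1 = j := by revert j; decide
      rw [this, Sym2.eq_swap]
      rfl
    · rw [se3, sv1, sv2 _ _ _ _ (by revert i; decide)]
      rfl
  two := by
    rintro (x | ⟨f, j⟩)
    · obtain ⟨p, q, hpq, h⟩ := T.two x
      refine ⟨((p.1, p.2 + 2), p.2), ((q.1, q.2 + 2), q.2), ?_, ?_⟩
      · intro h'
        simp only [Prod.mk.injEq] at h'
        exact hpq (Prod.ext h'.1.1 h'.2)
      · rintro ⟨⟨f, k⟩, i⟩
        rcases cases3 k i with rfl | ⟨j, rfl, rfl⟩ | rfl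
        · simp only
          rw [se1, Sum.inl.injEq, h (f, i)]
          constructor
          · rintro (rfl | rfl) <;> simp
          · simp only [Prod.mk.injEq]
            rintro (⟨⟨h1, h2⟩, h3⟩ | ⟨⟨h1, h2⟩, h3⟩)
            · exact Or.inl (Prod.ext h1 h3)
            · exact Or.inr (Prod.ext h1 h3)
        · simp only
          rw [se2]
          simp only [Prod.mk.injEq, false_iff, reduceCtorEq]
          rintro (⟨⟨h1, h2⟩, h3⟩ | ⟨⟨h1, h2⟩, h3⟩) <;> rw [← h3] at h2 <;> revert h2 <;>
            generalize (2 : Fin 3) + j = z <;> clear h3 <;> revert j <;> decide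
        · simp only
          rw [se3]
          simp only [Prod.mk.injEq, false_iff, reduceCtorEq]
          rintro (⟨⟨h1, h2⟩, h3⟩ | ⟨⟨h1, h2⟩, h3⟩) <;> rw [← h3] at h2 <;> revert h2 <;>
            clear h3 <;> revert i <;> decide
    · refine ⟨((f, j + 2), j + 2), ((f, j + 1), j), ?_, ?_⟩
      · intro h'
        simp only [Prod.mk.injEq] at h'
        have := h'.2
        revert this; clear h'; revert j; decide
      · rintro ⟨⟨f', k⟩, i⟩
        rcases cases3 k i with rfl | ⟨j', rfl, rfl⟩ | rfl
        · simp only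
          rw [se1]
          simp only [Prod.mk.injEq, false_iff, reduceCtorEq]
          rintro (⟨⟨h1, h2⟩, h3⟩ | ⟨⟨h1, h2⟩, h3⟩) <;> rw [h3] at h2 <;> revert h2 <;>
            clear h3 <;> revert j <;> decide
        · simp only
          rw [se2]
          simp only [Prod.mk.injEq, Sum.inr.injEq]
          have : (j' + 2 = j + 2 ↔ j' = j) ∧ ¬ (j' + 2 = j + 1 ∧ j' + 2 = j) := by
            revert j j'; decide
          tauto
        · simp only
          rw [se3]
          simp only [Prod.mk.injEq, Sum.inr.injEq]
          have : (i + 1 = j + 1 ↔ i = j) ∧ ¬ (i + 1 = j + 2 ∧ i = j + 2) := by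
            revert j i; decide
          tauto
  conn := by
    intro P h
    have h1 : ∀ a b, P (Sum.inl a) → P (Sum.inl b) := by
      apply T.conn (fun a => P (Sum.inl a))
      intro x a b hx
      exact h (Sum.inl x) _ _ (by simp [send, hx])
    have h2 : ∀ f, P (Sum.inl (T.v f 0)) → P (Sum.inr f) := fun f =>
      h (Sum.inr (f, 0)) _ _ rfl
    have h3 : ∀ f, P (Sum.inr f) → P (Sum.inl (T.v f 0)) := fun f =>
      h (Sum.inr (f, 0)) _ _ (by rw [Sym2.eq_swap]; rfl)
    rintro (a | a) (b | b) ha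
    · exact h1 _ _ ha
    · exact h2 _ (h1 _ _ ha)
    · exact h1 _ _ (h3 _ ha)
    · exact h2 _ (h1 _ _ (h3 _ ha))
  link := by
    rintro (x | f) P h
    · -- the two new corners of an old corner
      have hne1 : ∀ i : Fin 3, i ≠ i + 1 := by decide
      have hne2 : ∀ i : Fin 3, i ≠ i + 2 := by decide
      have e12 : ∀ f i, T.v f i = x → (P ((f, i + 1), i) ↔ P ((f, i + 2), i)) := by
        intro f i hx
        have a1 : T.sv (f, i + 1) i = Sum.inl x := by rw [sv2 _ _ _ _ (hne1 i), hx]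
        have a2 : T.sv (f, i + 2) i = Sum.inl x := by rw [sv2 _ _ _ _ (hne2 i), hx]
        have hi : i = i + 2 + 1 := f3b i
        have hpp : (((f, i + 1), i) : (F × Fin 3) × Fin 3) ≠ ((f, i + 2), i + 2) := by
          intro hh
          simp only [Prod.mk.injEq] at hh
          exact hne2 i hh.2
        have hc : (((f, i + 2), i) : (F × Fin 3) × Fin 3) = ((f, i + 2), i + 2 + 1) := by
          rw [← hi]
        constructor
        · refine h _ _ ((f, i + 1), i) ((f, i + 2), i + 2) a1 a2 hpp ?_ (Or.inl rfl) (Or.inr hc)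
          rw [se2, se3]
        · refine h _ _ ((f, i + 2), i + 2) ((f, i + 1), i) a2 a1 hpp.symm ?_ (Or.inr hc) (Or.inl rfl)
          rw [se2, se3]
      have key := T.link x (fun c => P ((c.1, c.2 + 1), c.2)) (by
        intro c c' p p' hc hc' hpp he hcp hcp' hP
        have conv : ∀ (c p : F × Fin 3), T.v c.1 c.2 = x → (c = p ∨ c = (p.1, p.2 + 1)) →
            ∃ d : (F × Fin 3) × Fin 3, (d = ((p.1, p.2 + 2), p.2) ∨ d = ((p.1, p.2 + 2), p.2 + 1))
              ∧ (P d ↔ P ((c.1, c.2 + 1), c.2)) ∧ T.sv d.1 d.2 = Sum.inl x := by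
          rintro c p hc (rfl | rfl)
          · exact ⟨_, Or.inl rfl, (e12 _ _ hc).symm, by rw [sv2 _ _ _ _ (hne2 _), hc]⟩
          · refine ⟨_, Or.inr rfl, ?_, ?_⟩
            · have : p.2 + 1 + 1 = p.2 + 2 := by rw [add_assoc]; rfl
              simp only [this]
            · rw [sv2 _ _ _ _ (by simp), hc]
        obtain ⟨d, hd1, hd2, hd3⟩ := conv c p hc hcp
        obtain ⟨d', hd1', hd2', hd3'⟩ := conv c' p' hc' hcp'
        refine hd2'.1 (h d d' _ _ hd3 hd3' ?_ ?_ hd1 hd1' (hd2.2 hP))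
        · intro hh
          simp only [Prod.mk.injEq] at hh
          exact hpp (Prod.ext hh.1.1 hh.2)
        · simp only
          rw [se1, se1, he])
      have norm : ∀ c : (F × Fin 3) × Fin 3, T.sv c.1 c.2 = Sum.inl x →
          T.v c.1.1 c.2 = x ∧ (P c ↔ P ((c.1.1, c.2 + 1), c.2)) := by
        rintro ⟨⟨f, k⟩, i⟩ hc
        have hik : i ≠ k := by
          rintro rfl
          rw [sv1] at hc
          simp at hc
        rw [sv2 _ _ _ _ hik, Sum.inl.injEq] at hc
        refine ⟨hc, ?_⟩
        have : k = i + 1 ∨ k = i + 2 := f3c i k hik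
        rcases this with rfl | rfl
        · rfl
        · exact (e12 _ _ hc).symm
      intro c c' hc hc' hP
      obtain ⟨n1, n2⟩ := norm c hc
      obtain ⟨n1', n2'⟩ := norm c' hc'
      exact n2'.2 (key (c.1.1, c.2) (c'.1.1, c'.2) n1 n1' (n2.1 hP))
    · have hstep : ∀ k : Fin 3, P ((f, k), k) → P ((f, k + 1), k + 1) := by
        intro k
        -- spoke k+2
        have hk : k = k + 2 + 1 := by revert k; decide
        have hk2 : k + 1 = k + 2 + 2 := by revert k; decide
        refine h _ _ ((f, k + 2 + 1), k + 2) ((f, k + 2 + 2), k + 2 + 2) (sv1 _ _ _) (sv1 _ _ _) ?_ ?_ ?_ ?_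
        · intro hh
          simp only [Prod.mk.injEq] at hh
          have := hh.2
          revert this; clear hh; clear hk hk2; revert k; decide
        · rw [se2, se3]
        · right; simp only [← hk]
        · left; simp only [← hk2]
      have norm : ∀ c : (F × Fin 3) × Fin 3, T.sv c.1 c.2 = Sum.inr f → c = ((f, c.2), c.2) := by
        rintro ⟨⟨f', k⟩, i⟩ hc
        by_cases hik : i = k
        · subst hik
          rw [sv1, Sum.inr.injEq] at hc
          simp [hc]
        · rw [sv2 _ _ _ _ hik] at hc
          simp at hc
      intro c c' hc hc' hP
      rw [norm c hc] at hP
      rw [norm c' hc']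
      generalize c.2 = a at hP
      generalize c'.2 = b
      have h2 := hstep _ hP
      have h3 := hstep _ h2
      have : b = a ∨ b = a + 1 ∨ b = a + 1 + 1 := f3a a b
      rcases this with rfl | rfl | rfl <;> assumption

end Tri

theorem ok_crn (α : List (Fin 3)) (i : Fin 3) : ok α.length (crn α i) := by
  induction α with
  | nil => exact trivial
  | cons k α ih =>
    unfold crn
    split_ifs
    · simp [ok]
    · revert ih
      cases crn α i with
      | inl _ => intro _; trivial
      | inr β => simp only [ok, List.length_cons]; omega

theorem tri_exists (n : ℕ) : ∃ (V E F : Type) (T : Tri V E F) (ψ : W → V) (fc : List (Fin 3) → F),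
    Finite V ∧ Finite E ∧ Finite F ∧
    (2 : ℤ) - ((Nat.card V : ℤ) - Nat.card E + Nat.card F) = 0 ∧
    (∀ x y, ok n x → ok n y → ψ x = ψ y → x = y) ∧
    (∀ α β, α.length = n → β.length = n → fc α = fc β → α = β) ∧
    (∀ α i, α.length = n → T.v (fc α) i = ψ (crn α i)) ∧
    (∀ α i, α.length < n → ∃ e, T.ends e = s(ψ (Sum.inr α), ψ (crn α i))) := by
  induction n with
  | zero =>
    refine ⟨_, _, _, Tri.base, fun w => match w with | Sum.inl i => i | Sum.inr _ => 0, fun _ => 0,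
      inferInstance, inferInstance, inferInstance, by simp, ?_, ?_, ?_, ?_⟩
    · rintro (x | x) (y | y) hx hy h
      · simpa using h
      · simp [ok] at hy
      · simp [ok] at hx
      · simp [ok] at hx
    · intro α β hα hβ _
      rw [List.length_eq_zero_iff] at hα hβ
      rw [hα, hβ]
    · intro α i hα
      rw [List.length_eq_zero_iff] at hα
      subst hα
      rfl
    · intro α i h
      simp at h
  | succ n ih =>
    obtain ⟨V, E, F, T, ψ, fc, hV, hE, hF, hg, hψ, hfc, hv, ha⟩ := ih
    let ψ' : W → V ⊕ F := fun w => match w with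
      | Sum.inl i => Sum.inl (ψ (Sum.inl i))
      | Sum.inr α => if α.length < n then Sum.inl (ψ (Sum.inr α)) else Sum.inr (fc α)
    let fc' : List (Fin 3) → F × Fin 3 := fun α => match α with
      | [] => (fc [], 0)
      | k :: α => (fc α, k)
    have hψok : ∀ w, ok n w → ψ' w = Sum.inl (ψ w) := by
      rintro (i | α) h
      · rfl
      · simp only [ok] at h
        simp only [ψ', if_pos h]
    have hψn : ∀ α : List (Fin 3), α.length = n → ψ' (Sum.inr α) = Sum.inr (fc α) := by
      intro α h
      simp [ψ', h]
    refine ⟨_, _, _, T.stack, ψ', fc', inferInstance, inferInstance, inferInstance, ?_, ?_, ?_, ?_, ?_⟩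
    · have := Fintype.ofFinite V
      have := Fintype.ofFinite E
      have := Fintype.ofFinite F
      simp only [Nat.card_eq_fintype_card, Fintype.card_sum, Fintype.card_prod, Fintype.card_fin] at hg ⊢
      push_cast
      linarith
    · have cs : ∀ w, ok (n + 1) w → ok n w ∨ ∃ α : List (Fin 3), α.length = n ∧ w = Sum.inr α := by
        rintro (i | α) h
        · exact Or.inl trivial
        · simp only [ok] at h ⊢
          rcases Nat.lt_succ_iff_lt_or_eq.1 h with h | h
          · exact Or.inl h
          · exact Or.inr ⟨α, h, rfl⟩
      intro x y hx hy hxy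
      rcases cs x hx with hx' | ⟨α, hα, rfl⟩ <;> rcases cs y hy with hy' | ⟨β, hβ, rfl⟩
      · rw [hψok _ hx', hψok _ hy', Sum.inl.injEq] at hxy
        exact hψ _ _ hx' hy' hxy
      · rw [hψok _ hx', hψn _ hβ] at hxy
        simp at hxy
      · rw [hψok _ hy', hψn _ hα] at hxy
        simp at hxy
      · rw [hψn _ hα, hψn _ hβ, Sum.inr.injEq] at hxy
        rw [hfc _ _ hα hβ hxy]
    · rintro (_ | ⟨k, α⟩) (_ | ⟨l, β⟩) hα hβ h
      · rfl
      · simp at hα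
      · simp at hβ
      · simp only [List.length_cons, Nat.add_right_cancel_iff] at hα hβ
        simp only [fc', Prod.mk.injEq] at h
        rw [h.2, hfc _ _ hα hβ h.1]
    · rintro (_ | ⟨k, α⟩) i hα
      · simp at hα
      · simp only [List.length_cons, Nat.add_right_cancel_iff] at hα
        change T.sv (fc α, k) i = _
        unfold crn Tri.sv
        simp only
        split_ifs with hik
        · rw [hψn _ hα]
        · rw [hv _ _ hα, hψok]
          have := ok_crn α i
          rwa [hα] at this
    · intro α i hα
      have hok : ok α.length (crn α i) := ok_crn α i
      rcases Nat.lt_succ_iff_lt_or_eq.1 hα with h | h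
      · obtain ⟨e, he⟩ := ha α i h
        refine ⟨Sum.inl e, ?_⟩
        rw [hψok _ (show ok n (Sum.inr α) from h), hψok]
        · change (T.ends e).map Sum.inl = _
          rw [he]; rfl
        · revert hok
          cases crn α i with
          | inl _ => intro _; trivial
          | inr β => simp only [ok]; omega
      · refine ⟨Sum.inr (fc α, i), ?_⟩
        rw [hψn _ h, hψok _ (h ▸ hok), ← hv _ _ h, Sym2.eq_swap]
        rfl

namespace Tri

variable {V E F : Type}

def mg (T : Tri V E F) : Multigraph V E := ⟨T.ends⟩

def cw (T : Tri V E F) (f : F) : T.mg.CWalk where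
  len := 3
  len_pos := by norm_num
  vtx i := T.v f (Fin.ofNat 3 i)
  edge i := T.e f (Fin.ofNat 3 i)
  vtx_per i := by congr 1; ext; simp [Fin.ofNat]
  edge_per i := by congr 1; ext; simp [Fin.ofNat]
  compat i := by
    change T.ends _ = _
    rw [T.hends]
    congr 3
    ext; simp [Fin.ofNat, Fin.val_add]

theorem ofNat_val (i : Fin 3) : Fin.ofNat 3 i.1 = i := by
  ext; simp [Fin.ofNat, Nat.mod_eq_of_lt i.2]

theorem emb_exists (T : Tri V E F) [Nonempty V] : Nonempty (T.mg.Embedding F) := by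
  refine ⟨⟨T.cw, ?_, ?_, ?_⟩⟩
  · refine ⟨fun a b => ?_⟩
    refine T.conn (fun b => T.mg.simple.Reachable a b) ?_ a b (SimpleGraph.Reachable.refl _)
    intro x c d hx hc
    by_cases hcd : c = d
    · rwa [← hcd]
    · exact hc.trans (SimpleGraph.Adj.reachable ⟨hcd, x, hx⟩)
  · intro x
    obtain ⟨p, q, hpq, h⟩ := T.two x
    rw [Set.ncard_eq_two]
    refine ⟨(p.1, p.2.1), (q.1, q.2.1), ?_, ?_⟩
    · intro hh
      simp only [Prod.mk.injEq] at hh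
      exact hpq (Prod.ext hh.1 (Fin.ext hh.2))
    · ext ⟨f, i⟩
      simp only [Set.mem_ofPred_eq, Multigraph.IsOcc, Set.mem_insert_iff, Set.mem_singleton_iff]
      constructor
      · rintro ⟨h1, h2⟩
        rcases (h (f, Fin.ofNat 3 i)).1 h2 with h' | h'
        · left
          have hi : (Fin.ofNat 3 i).1 = i := Nat.mod_eq_of_lt h1
          rw [← h']; simp only [hi]
        · right
          have hi : (Fin.ofNat 3 i).1 = i := Nat.mod_eq_of_lt h1
          rw [← h']; simp only [hi]
      · have aux : ∀ p : F × Fin 3, T.e p.1 p.2 = x → (f, i) = (p.1, p.2.1) →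
            i < (T.cw f).len ∧ (T.cw f).edge i = x := by
          intro p hp hh
          simp only [Prod.mk.injEq] at hh
          obtain ⟨rfl, rfl⟩ := hh
          refine ⟨p.2.2, ?_⟩
          change T.e _ (Fin.ofNat 3 p.2.1) = x
          rw [ofNat_val, hp]
        rintro (h' | h')
        · exact aux p ((h p).2 (Or.inl rfl)) h'
        · exact aux q ((h q).2 (Or.inr rfl)) h'
  · intro x c c' hc hc'
    have key := T.link x (fun d => Relation.EqvGen (Multigraph.CornerLinked T.cw x) c (d.1, d.2.1)) (by
      intro d d' p p' hd hd' hpp he hdp hdp' hP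
      refine hP.trans _ _ _ (Relation.EqvGen.rel _ _ ?_)
      have hcor : ∀ d : F × Fin 3, T.v d.1 d.2 = x → Multigraph.IsCorner T.cw x (d.1, d.2.1) := by
        intro d hd
        refine ⟨d.2.2, ?_⟩
        change T.v _ (Fin.ofNat 3 d.2.1) = x
        rw [ofNat_val, hd]
      have hend : ∀ d p : F × Fin 3, (d = p ∨ d = (p.1, p.2 + 1)) →
          Multigraph.EndOf T.cw (d.1, d.2.1) (p.1, p.2.1) := by
        rintro d p (rfl | rfl)
        · exact ⟨rfl, Or.inl rfl⟩
        · exact ⟨rfl, Or.inr (by simp [Fin.val_add, cw])⟩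
      refine ⟨hcor _ hd, hcor _ hd', T.e p.1 p.2, (p.1, p.2.1), (p'.1, p'.2.1), ?_, ?_, ?_,
        hend _ _ hdp, hend _ _ hdp'⟩
      · intro hh
        simp only [Prod.mk.injEq] at hh
        exact hpp (Prod.ext hh.1 (Fin.ext hh.2))
      · refine ⟨p.2.2, ?_⟩
        change T.e _ (Fin.ofNat 3 p.2.1) = _
        rw [ofNat_val]
      · refine ⟨p'.2.2, ?_⟩
        change T.e _ (Fin.ofNat 3 p'.2.1) = _
        rw [ofNat_val, he])
    obtain ⟨f, i⟩ := c
    obtain ⟨f', i'⟩ := c'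
    have hi : (Fin.ofNat 3 i).1 = i := Nat.mod_eq_of_lt hc.1
    have hi' : (Fin.ofNat 3 i').1 = i' := Nat.mod_eq_of_lt hc'.1
    have := key (f, Fin.ofNat 3 i) (f', Fin.ofNat 3 i') hc.2 hc'.2 (by
      simp only [hi]; exact Relation.EqvGen.refl _)
    simpa only [hi'] using this

end Tri

theorem planar_HG (n : ℕ) : HasEulerGenusLE (HG n) 0 := by
  obtain ⟨V, E, F, T, ψ, fc, hV, hE, hF, hg, hψ, -, -, ha⟩ := tri_exists n
  have : Nonempty V := ⟨ψ (Sum.inl 0)⟩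
  obtain ⟨emb⟩ := T.emb_exists
  refine ⟨V, E, F, hV, hE, hF, T.mg, emb, ?_, ?_⟩
  · unfold Multigraph.Embedding.eulerGenus
    rw [hg]; simp
  · refine ⟨⟨fun w => ψ w.1, ?_⟩, ?_⟩
    · rintro ⟨x, hx⟩ ⟨y, hy⟩ ⟨hne, α, i, h | h⟩
      · refine ⟨fun h' => hne (Subtype.ext (hψ _ _ hx hy h')), ?_⟩
        simp only at h
        rw [h.1] at hx
        obtain ⟨e, he⟩ := ha α i hx
        exact ⟨e, by simp only [h.1, h.2]; exact he⟩
      · refine ⟨fun h' => hne (Subtype.ext (hψ _ _ hx hy h')), ?_⟩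
        simp only at h
        rw [h.1] at hy
        obtain ⟨e, he⟩ := ha α i hy
        exact ⟨e, by simp only [h.1, h.2]; rw [Sym2.eq_swap]; exact he⟩
    · rintro ⟨x, hx⟩ ⟨y, hy⟩ h
      exact Subtype.ext (hψ _ _ hx hy h)

theorem apex_HG (n : ℕ) : IsApex (HG n) := by
  refine ⟨⟨Sum.inl 0, trivial⟩, ?_⟩
  obtain ⟨V, E, F, hV, hE, hF, M, emb, h1, f, hf⟩ := planar_HG n
  refine ⟨V, E, F, hV, hE, hF, M, emb, h1, ⟨fun w => f w.1, ?_⟩, ?_⟩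
  · intro a b hab
    exact f.map_adj hab
  · intro a b h
    exact Subtype.ext (hf h)

end GPS


namespace GPS

theorem exists_max_pair (R : ℚ → ℚ → Prop) (P : Finset ℚ) (hP : ∀ i j, R i j → i ∈ P ∧ j ∈ P)
    (f : ℚ → ℚ → ℚ) (hne : ∃ i j, R i j) :
    ∃ i j, R i j ∧ ∀ a b, R a b → f a b ≤ f i j := by
  classical
  obtain ⟨i, j, h⟩ := hne
  obtain ⟨m, hm, hmax⟩ := Finset.exists_max_image ((P ×ˢ P).filter (fun p => R p.1 p.2))
    (fun p => f p.1 p.2) ⟨(i, j), by simp [h, hP i j h]⟩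
  simp only [Finset.mem_filter, Finset.mem_product] at hm hmax
  exact ⟨m.1, m.2, hm.2, fun a b hab => hmax (a, b) ⟨hP a b hab, hab⟩⟩

/-- a point just below / above avoiding a finite set -/
theorem exists_gap (P : Finset ℚ) (x lo hi : ℚ) (h1 : lo < x) (h2 : x < hi) (hx : x ∉ P) :
    ∃ q s, lo < q ∧ q < x ∧ x < s ∧ s < hi ∧ ∀ t ∈ P, ¬ (q ≤ t ∧ t ≤ s) := by
  classical
  have key : ∀ P : Finset ℚ, x ∉ P → ∃ q s, lo < q ∧ q < x ∧ x < s ∧ s < hi ∧ ∀ t ∈ P, ¬ (q ≤ t ∧ t ≤ s) := by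
    intro P
    induction P using Finset.induction_on with
    | empty =>
      intro _
      obtain ⟨q, hq⟩ := exists_between h1
      obtain ⟨s, hs⟩ := exists_between h2
      exact ⟨q, s, hq.1, hq.2, hs.1, hs.2, by simp⟩
    | insert t P _ ih =>
      intro hx
      simp only [Finset.mem_insert, not_or] at hx
      obtain ⟨q, s, a1, a2, a3, a4, a5⟩ := ih hx.2
      rcases lt_or_gt_of_ne hx.1 with h | h
      · obtain ⟨s', hs'⟩ := exists_between (lt_min h a3)
        refine ⟨q, s', a1, a2, hs'.1, (hs'.2.trans_le (min_le_right _ _)).trans a4, ?_⟩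
        have b1 := hs'.2.trans_le (min_le_right _ _)
        have b2 := hs'.2.trans_le (min_le_left _ _)
        simp only [Finset.mem_insert, forall_eq_or_imp]
        exact ⟨fun hh => absurd hh.2 (not_le.2 b2), fun u hu hh => a5 u hu ⟨hh.1, hh.2.trans b1.le⟩⟩
      · obtain ⟨q', hq'⟩ := exists_between (max_lt h a2)
        have b1 := (le_max_right t q).trans_lt hq'.1
        have b2 := (le_max_left t q).trans_lt hq'.1
        refine ⟨q', s, a1.trans b1, hq'.2, a3, a4, ?_⟩
        simp only [Finset.mem_insert, forall_eq_or_imp]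
        exact ⟨fun hh => absurd hh.1 (not_le.2 b2), fun u hu hh => a5 u hu ⟨b1.le.trans hh.1, hh.2⟩⟩
  exact key P hx

def GoodT (E : ℚ → ℚ → Prop) (y1 y2 y3 : ℚ) : Prop :=
  ∀ i j, E i j → (y1 ≤ i ∧ j ≤ y2) ∨ (y2 ≤ i ∧ j ≤ y3) ∨ ((i ≤ y1 ∨ y3 ≤ i) ∧ (j ≤ y1 ∨ y3 ≤ j))

theorem step_one (E : ℚ → ℚ → Prop) (P : Finset ℚ) (hP : ∀ i j, E i j → i ∈ P ∧ j ∈ P)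
    (hlt : ∀ i j, E i j → i < j)
    (hnc : ∀ i j k l, E i j → E k l → ¬ (i < k ∧ k < j ∧ j < l))
    (x1 x2 x3 : ℚ) (h12 : x1 < x2) (h23 : x2 < x3) (hx2 : x2 ∉ P) :
    ∃ q s, x1 < q ∧ q < x2 ∧ x2 < s ∧ s < x3 ∧
      (∀ i j, E i j → (q ≤ i ∧ j ≤ s) ∨ ((i ≤ q ∨ s ≤ i) ∧ (j ≤ q ∨ s ≤ j))) ∧
      (∀ i j, E i j → x1 < i → i ≤ q → s ≤ j → j < x3 → i = q ∧ j = s) ∧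
      (E q s ∨ ∀ i j, E i j → (i < q ∨ s < i) ∧ (j < q ∨ s < j)) := by
  by_cases hne : ∃ i j, E i j ∧ x1 < i ∧ i < x2 ∧ x2 < j ∧ j < x3
  · obtain ⟨q, s, ⟨hE, a1, a2, a3, a4⟩, hmax⟩ := exists_max_pair
      (fun i j => E i j ∧ x1 < i ∧ i < x2 ∧ x2 < j ∧ j < x3) P (fun i j h => hP i j h.1)
      (fun i j => j - i) hne
    refine ⟨q, s, a1, a2, a3, a4, ?_, ?_, Or.inl hE⟩
    · intro i j hij
      have h1 := hnc _ _ _ _ hE hij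
      have h2 := hnc _ _ _ _ hij hE
      have h3 := hlt _ _ hij
      grind
    · intro i j hij b1 b2 b3 b4
      have := hmax i j ⟨hij, b1, by linarith, by linarith, b4⟩
      constructor <;> linarith
  · obtain ⟨q, s, a1, a2, a3, a4, a5⟩ := exists_gap P x2 x1 x3 h12 h23 hx2
    have a5' : ∀ i j, E i j → (i < q ∨ s < i) ∧ (j < q ∨ s < j) := by
      intro i j hij
      have c1 := a5 i (hP _ _ hij).1
      have c2 := a5 j (hP _ _ hij).2
      grind
    refine ⟨q, s, a1, a2, a3, a4, ?_, ?_, Or.inr a5'⟩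
    · intro i j hij
      have := a5' _ _ hij
      grind
    · intro i j hij b1 b2 b3 b4
      exact absurd ⟨i, j, hij, b1, by linarith, by linarith, b4⟩ hne

theorem good_triple (E : ℚ → ℚ → Prop) (P : Finset ℚ) (U : Set ℚ)
    (hP : ∀ i j, E i j → i ∈ P ∧ j ∈ P)
    (hlt : ∀ i j, E i j → i < j)
    (hnc : ∀ i j k l, E i j → E k l → ¬ (i < k ∧ k < j ∧ j < l))
    (hU : ∀ i j, E i j → i ∈ U ∨ j ∈ U) (hne : ∃ i j, E i j)
    (x1 x2 x3 : ℚ) (h12 : x1 < x2) (h23 : x2 < x3) (hx1 : x1 ∉ P) (hx2 : x2 ∉ P) (hx3 : x3 ∉ P) :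
    ∃ y1 y2 y3, ((y1 < x1 ∧ x1 < y2 ∧ y2 < x2 ∧ x2 < y3 ∧ y3 < x3) ∨
        (x1 < y1 ∧ y1 < x2 ∧ x2 < y2 ∧ y2 < x3 ∧ x3 < y3)) ∧
      (y1 ∈ U ∨ y2 ∈ U ∨ y3 ∈ U) ∧ GoodT E y1 y2 y3 := by
  obtain ⟨q, s, a1, a2, a3, a4, F1, F2, hqs⟩ := step_one E P hP hlt hnc x1 x2 x3 h12 h23 hx2
  have nx : ∀ i j, E i j → i ≠ x1 ∧ i ≠ x3 ∧ j ≠ x1 ∧ j ≠ x3 := by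
    intro i j h
    have := hP i j h
    refine ⟨?_, ?_, ?_, ?_⟩ <;> rintro rfl <;> tauto
  by_cases hi : ∃ i j, E i j ∧ x1 < i ∧ i ≤ q ∧ x3 < j
  · obtain ⟨i', j, ⟨hE', b1', b2', b3⟩, hmin⟩ := exists_max_pair
      (fun i j => E i j ∧ x1 < i ∧ i ≤ q ∧ x3 < j) P (fun i j h => hP i j h.1)
      (fun i j => - j) hi
    obtain ⟨i, j', ⟨⟨hE, b1, b2, -⟩, hj'⟩, hmax⟩ := exists_max_pair
      (fun i k => (E i k ∧ x1 < i ∧ i ≤ q ∧ x3 < k) ∧ k = j) P (fun i j h => hP i j h.1.1)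
      (fun i j => i) ⟨i', j, ⟨hE', b1', b2', b3⟩, rfl⟩
    subst hj'
    refine ⟨i, s, j', Or.inr ⟨b1, by linarith, a3, a4, b3⟩, ?_, ?_⟩
    · rcases hU _ _ hE with h | h <;> simp [h]
    · intro a b hab
      have n1 := hnc _ _ _ _ hE hab
      have n2 := hnc _ _ _ _ hab hE
      have n3 := hlt _ _ hab
      have n4 := F1 _ _ hab
      have n5 := F2 _ _ hab
      have n6 := nx _ _ hab
      have m1 : x1 < a → a ≤ q → x3 < b → j' ≤ b := fun h1 h2 h3 => by
        have := hmin a b ⟨hab, h1, h2, h3⟩; linarith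
      have m2 : x1 < a → a ≤ q → x3 < b → b = j' → a ≤ i := fun h1 h2 h3 h4 =>
        hmax a b ⟨⟨hab, h1, h2, h3⟩, h4⟩
      grind
  by_cases hii : ∃ i j, E i j ∧ i < x1 ∧ s ≤ j
  · obtain ⟨i, j', ⟨hE', b1, b2'⟩, hmax⟩ := exists_max_pair
      (fun i j => E i j ∧ i < x1 ∧ s ≤ j) P (fun i j h => hP i j h.1)
      (fun i j => i) hii
    obtain ⟨i', j, ⟨⟨hE, -, b2⟩, hi'⟩, hmin⟩ := exists_max_pair
      (fun k j => (E k j ∧ k < x1 ∧ s ≤ j) ∧ k = i) P (fun i j h => hP i j h.1.1)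
      (fun i j => -j) ⟨i, j', ⟨hE', b1, b2'⟩, rfl⟩
    subst hi'
    have m1 : ∀ a b, E a b → a < x1 → s ≤ b → a ≤ i' := fun a b h1 h2 h3 => hmax a b ⟨h1, h2, h3⟩
    have m2 : ∀ a b, E a b → a < x1 → s ≤ b → a = i' → j ≤ b := fun a b h1 h2 h3 h4 => by
      have := hmin a b ⟨⟨h1, h2, h3⟩, h4⟩; linarith
    have m3 : ∀ a b, E a b → x1 < a → a ≤ q → b ≤ x3 := fun a b h1 h2 h3 => by
      by_contra h
      exact hi ⟨a, b, h1, h2, h3, not_le.1 h⟩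
    have n7 := nx _ _ hE
    rcases hU _ _ hE with h | h
    · refine ⟨i', q, s, Or.inl ⟨b1, a1, a2, a3, a4⟩, Or.inl h, ?_⟩
      intro a b hab
      have n1 := hnc _ _ _ _ hE hab
      have n2 := hnc _ _ _ _ hab hE
      have n3 := hlt _ _ hab
      have n4 := F1 _ _ hab
      have n5 := F2 _ _ hab
      have n6 := nx _ _ hab
      have n8 := m1 _ _ hab
      have n9 := m2 _ _ hab
      have n10 := m3 _ _ hab
      grind
    · rcases lt_or_gt_of_ne n7.2.2.2 with h' | h'
      · refine ⟨i', q, j, Or.inl ⟨b1, a1, a2, by linarith, h'⟩, Or.inr (Or.inr h), ?_⟩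
        intro a b hab
        have n1 := hnc _ _ _ _ hE hab
        have n2 := hnc _ _ _ _ hab hE
        have n3 := hlt _ _ hab
        have n4 := F1 _ _ hab
        have n5 := F2 _ _ hab
        have n6 := nx _ _ hab
        have n8 := m1 _ _ hab
        have n9 := m2 _ _ hab
        have n10 := m3 _ _ hab
        grind
      · refine ⟨q, s, j, Or.inr ⟨a1, a2, a3, a4, h'⟩, Or.inr (Or.inr h), ?_⟩
        intro a b hab
        have n1 := hnc _ _ _ _ hE hab
        have n2 := hnc _ _ _ _ hab hE
        have n3 := hlt _ _ hab
        have n4 := F1 _ _ hab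
        have n5 := F2 _ _ hab
        have n6 := nx _ _ hab
        have n8 := m1 _ _ hab
        have n9 := m2 _ _ hab
        have n10 := m3 _ _ hab
        grind
  have sep : ∀ a b, E a b → (a < b ∧ b ≤ q) ∨ (q ≤ a ∧ b ≤ s) ∨ (s ≤ a ∧ a < b) := by
    intro a b hab
    have n3 := hlt _ _ hab
    have n4 := F1 _ _ hab
    have n5 := F2 _ _ hab
    have n6 := nx _ _ hab
    have c1 : x1 < a → a ≤ q → b ≤ x3 := fun h2 h3 => by
      by_contra h
      exact hi ⟨a, b, hab, h2, h3, not_le.1 h⟩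
    have c2 : a < x1 → b < s := fun h2 => by
      by_contra h
      exact hii ⟨a, b, hab, h2, not_lt.1 h⟩
    grind
  obtain ⟨p, hp1, hp⟩ : ∃ p, p < x1 ∧ ∀ t ∈ P, p ≤ t := by
    classical
    obtain ⟨p, hp⟩ := (insert x1 P).bddBelow
    refine ⟨p - 1, ?_, fun t ht => ?_⟩
    · have := hp (show x1 ∈ _ by simp)
      linarith
    · have := hp (show t ∈ _ by simp [ht])
      linarith
  rcases hqs with hqs | hqs
  · refine ⟨p, q, s, Or.inl ⟨hp1, a1, a2, a3, a4⟩, ?_, ?_⟩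
    · rcases hU _ _ hqs with h | h <;> simp [h]
    · intro a b hab
      have c1 := hp _ (hP _ _ hab).1
      have c2 := sep _ _ hab
      grind
  · obtain ⟨i, j, hE, hmax⟩ := exists_max_pair E P hP (fun i j => j - i) hne
    obtain ⟨e, heU, hee⟩ : ∃ e, e ∈ U ∧ (e = i ∨ e = j) := by
      rcases hU _ _ hE with h | h
      · exact ⟨i, h, Or.inl rfl⟩
      · exact ⟨j, h, Or.inr rfl⟩
    have hunc : ∀ a b, E a b → e ≤ a ∨ b ≤ e := by
      intro a b hab
      have n1 := hnc _ _ _ _ hE hab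
      have n2 := hnc _ _ _ _ hab hE
      have n3 := hlt _ _ hab
      have n4 := hlt _ _ hE
      have n5 := hmax _ _ hab
      grind
    have hepos : (e < q ∨ s < e) ∧ e ≠ x1 ∧ e ≠ x3 := by
      have c1 := hqs _ _ hE
      have c2 := nx _ _ hE
      grind
    rcases hepos with ⟨h | h, e1, e3⟩
    · rcases lt_or_gt_of_ne e1 with h' | h'
      · refine ⟨e, q, s, Or.inl ⟨h', a1, a2, a3, a4⟩, Or.inl heU, ?_⟩
        intro a b hab
        have c1 := hp _ (hP _ _ hab).1
        have c2 := sep _ _ hab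
        have c3 := hunc _ _ hab
        grind
      · refine ⟨p, e, s, Or.inl ⟨hp1, h', by linarith, a3, a4⟩, Or.inr (Or.inl heU), ?_⟩
        intro a b hab
        have c1 := hp _ (hP _ _ hab).1
        have c2 := sep _ _ hab
        have c3 := hunc _ _ hab
        grind
    · rcases lt_or_gt_of_ne e3 with h' | h'
      · refine ⟨p, q, e, Or.inl ⟨hp1, a1, a2, by linarith, h'⟩, Or.inr (Or.inr heU), ?_⟩
        intro a b hab
        have c1 := hp _ (hP _ _ hab).1
        have c2 := sep _ _ hab
        have c3 := hunc _ _ hab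
        grind
      · refine ⟨q, s, e, Or.inr ⟨a1, a2, a3, a4, h'⟩, Or.inr (Or.inr heU), ?_⟩
        intro a b hab
        have c1 := hp _ (hP _ _ hab).1
        have c2 := sep _ _ hab
        have c3 := hunc _ _ hab
        grind

end GPS


namespace GPS

structure Ctx (V : Type) where
  G : SimpleGraph V
  A : V → V → Prop
  Arefl : ∀ v, A v v
  Atrans : ∀ u v w, A u v → A v w → A u w
  Z : Set V
  Pos : Finset ℚ
  lab : ℚ → V
  N : ℚ → ℚ → Prop
  Nlt : ∀ i j, N i j → i < j
  NP : ∀ i j, N i j → i ∈ Pos ∧ j ∈ Pos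
  nc : ∀ i j k l, N i j → N k l → ¬ (i < k ∧ k < j ∧ j < l)
  adj : ∀ u w, G.Adj u w → ∃ i j, (N i j ∨ N j i) ∧ lab i = u ∧ lab j = w
  surj : ∀ v, ∃ t ∈ Pos, lab t = v
  conv : ∀ v, v ∉ Z → ∀ i j k, i ∈ Pos → j ∈ Pos → k ∈ Pos → i < j → j < k →
    A (lab i) v → A (lab k) v → A (lab j) v
  consec : ∀ i k, i ∈ Pos → k ∈ Pos → i < k → (∀ t ∈ Pos, ¬ (i < t ∧ t < k)) → N i k
  hZ : ∃ t ∈ Pos, lab t ∈ Z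

variable {V : Type} (C : Ctx V)

def Ctx.T (v : V) (t : ℚ) : Prop := t ∈ C.Pos ∧ C.A (C.lab t) v

def Ctx.nsep (x : ℚ) (v : V) : Prop := ∀ s t, C.T v s → C.T v t → s < x → t < x

theorem Ctx.T_self {t : ℚ} (h : t ∈ C.Pos) : C.T (C.lab t) t := ⟨h, C.Arefl _⟩

def bi (x1 x2 x3 t : ℚ) : Fin 3 := if t < x1 then 0 else if t < x2 then 1 else if t < x3 then 2 else 0

structure Reg (α : List (Fin 3)) (S : Set V) (φ0 : V → W) (x1 x2 x3 : ℚ) (π : Fin 3 → Fin 3) :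
    Prop where
  hS : ∀ v ∈ S, v ∉ C.Z
  desc : ∀ v ∈ S, ∀ x, C.A x v → x ∈ S
  lt12 : x1 < x2
  lt23 : x2 < x3
  n1 : x1 ∉ C.Pos
  n2 : x2 ∉ C.Pos
  n3 : x3 ∉ C.Pos
  inj : Function.Injective π
  r2 : ∀ i j, (C.N i j ∨ C.N j i) → C.lab i ∈ S → C.lab j ∉ S →
    φ0 (C.lab j) = crn α (π (bi x1 x2 x3 j))
  r31 : ∀ v ∈ S, C.nsep x1 v
  r32 : ∀ v ∈ S, C.nsep x2 v
  r33 : ∀ v ∈ S, C.nsep x3 v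

def Sol (α : List (Fin 3)) (S : Set V) (φ0 : V → W) : Prop :=
  ∃ φ : V → W, (∀ v, v ∉ S → φ v = φ0 v) ∧ (∀ v ∈ S, ∃ β, φ v = Sum.inr β ∧ α <:+ β) ∧
    (∀ u ∈ S, ∀ w, C.G.Adj u w → φ u = φ w ∨ HR (φ u) (φ w)) ∧
    ∀ β, ∃ a : Fin 3 → V, ∀ u ∈ S, φ u = Sum.inr β → ∃ i, C.A (a i) u

theorem consec_induct (P : Finset ℚ) (Q : ℚ → Prop) (s t : ℚ) (hs : s ∈ P) (ht : t ∈ P)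
    (hst : s ≤ t) (hQ : Q s)
    (h : ∀ i k, i ∈ P → k ∈ P → s ≤ i → i < k → k ≤ t → (∀ u ∈ P, ¬ (i < u ∧ u < k)) → Q i → Q k) :
    Q t := by
  classical
  obtain ⟨m, hm, hmax⟩ := Finset.exists_max_image (P.filter (fun u => s ≤ u ∧ u ≤ t ∧ Q u)) id
    ⟨s, by simp [hs, hst, hQ]⟩
  simp only [Finset.mem_filter, id] at hm hmax
  obtain ⟨hmP, hsm, hmt, hQm⟩ := hm
  rcases eq_or_lt_of_le hmt with rfl | hlt
  · exact hQm
  · obtain ⟨k, hk, hmin⟩ := Finset.exists_min_image (P.filter (fun u => m < u)) id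
      ⟨t, by simp [ht, hlt]⟩
    simp only [Finset.mem_filter, id] at hk hmin
    have hkt := hmin t ⟨ht, hlt⟩
    have hQk := h m k hmP hk.1 hsm hk.2 hkt
      (fun u hu hh => absurd (hmin u ⟨hu, hh.1⟩) (not_le.2 hh.2)) hQm
    exact absurd (hmax k ⟨hk.1, hsm.trans hk.2.le, hkt, hQk⟩) (not_le.2 hk.2)

theorem just_above (P : Finset ℚ) (u : ℚ) : ∃ R, u < R ∧ ∀ t ∈ P, u < t → R < t := by
  classical
  induction P using Finset.induction_on with
  | empty => exact ⟨u + 1, by linarith, by simp⟩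
  | insert a P _ ih =>
    obtain ⟨R, h1, h2⟩ := ih
    by_cases ha : u < a
    · obtain ⟨R', b1, b2⟩ := exists_between (lt_min ha h1)
      refine ⟨R', b1, ?_⟩
      simp only [Finset.mem_insert, forall_eq_or_imp]
      exact ⟨fun _ => b2.trans_le (min_le_left _ _),
        fun t ht hut => (b2.trans_le (min_le_right _ _)).trans (h2 t ht hut)⟩
    · refine ⟨R, h1, ?_⟩
      simp only [Finset.mem_insert, forall_eq_or_imp]
      exact ⟨fun h => absurd h ha, h2⟩

theorem just_below (P : Finset ℚ) (u : ℚ) : ∃ R, R < u ∧ ∀ t ∈ P, t < u → t < R := by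
  classical
  obtain ⟨R, h1, h2⟩ := just_above (P.image (fun t => -t)) (-u)
  refine ⟨-R, by linarith, fun t ht htu => ?_⟩
  have := h2 (-t) (Finset.mem_image_of_mem _ ht) (by linarith)
  linarith

variable {C}

/-- walking: if `T v` is separated by `y` there is an N-edge of `T v` straddling `y` -/
theorem straddle {v : V} (hv : v ∉ C.Z) {s t y : ℚ} (hs : C.T v s) (ht : C.T v t) (hsy : s < y)
    (hyt : y ≤ t) : ∃ i k, C.N i k ∧ C.T v i ∧ C.T v k ∧ i < y ∧ y ≤ k := by
  by_contra hcon
  have hTc : ∀ j ∈ C.Pos, s ≤ j → j ≤ t → C.T v j := by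
    intro j hj h1 h2
    rcases eq_or_lt_of_le h1 with rfl | h1
    · exact hs
    rcases eq_or_lt_of_le h2 with rfl | h2
    · exact ht
    exact ⟨hj, C.conv v hv s j t hs.1 hj ht.1 h1 h2 hs.2 ht.2⟩
  have := consec_induct C.Pos (fun u => u < y) s t hs.1 ht.1 (hsy.le.trans hyt) hsy (by
    intro i k hi hk h1 h2 h3 h4 h5
    by_contra h6
    exact hcon ⟨i, k, C.consec i k hi hk h2 h4, hTc i hi h1 (h2.le.trans h3), hTc k hk (h1.trans h2.le) h3,
      h5, not_lt.1 h6⟩)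
  exact absurd this (not_lt.2 hyt)

variable {α : List (Fin 3)} {S : Set V} {φ0 : V → W} {x1 x2 x3 : ℚ} {π : Fin 3 → Fin 3}

theorem lemZ (P' : Finset ℚ) (hS : ∀ v ∈ S, v ∉ C.Z) (desc : ∀ v ∈ S, ∀ x, C.A x v → x ∈ S)
    (hP' : ∀ x ∈ P', x ∉ C.Pos ∧ ∀ v ∈ S, C.nsep x v)
    (y : ℚ) (hy : y ∉ P') :
    ∃ R, R ∉ C.Pos ∧ (∀ x ∈ P', (x < y ↔ x < R) ∧ (y < x ↔ R < x)) ∧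
      (∀ t ∈ C.Pos, y ≤ t → C.lab t ∈ S → C.T (C.lab t) y → t < R) ∧
      (∀ t ∈ C.Pos, y ≤ t → C.lab t ∉ S → R < t) ∧
      (∀ v ∈ S, ¬ C.T v y → C.nsep y v → C.nsep R v) := by
  classical
  by_cases h : y ∈ C.Pos ∧ C.lab y ∈ S
  · obtain ⟨u, hu, hmax⟩ := Finset.exists_max_image
      (C.Pos.filter (fun t => y ≤ t ∧ C.lab t ∈ S ∧ C.T (C.lab t) y)) id
      ⟨y, by simp [h.1, h.2, C.T_self h.1]⟩
    simp only [Finset.mem_filter, id] at hu hmax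
    obtain ⟨huP, hyu, huS, huT⟩ := hu
    obtain ⟨R, hR1, hR2⟩ := just_above (C.Pos ∪ P') u
    have hRP : ∀ t ∈ C.Pos, u < t → R < t := fun t ht => hR2 t (by simp [ht])
    refine ⟨R, fun hR => lt_irrefl _ (hRP R hR hR1), ?_, ?_, ?_, ?_⟩
    · intro x hx
      have c1 : u < x → R < x := hR2 x (by simp [hx])
      have c2 : u ≠ x := fun e => (hP' x hx).1 (e ▸ huP)
      have c3 := (hP' x hx).2 _ huS y u huT (C.T_self huP)
      have c4 : x ≠ y := fun e => hy (e ▸ hx)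
      grind
    · intro t ht hyt htS htT
      exact (hmax t ⟨ht, hyt, htS, htT⟩).trans_lt hR1
    · intro t ht hyt htS
      apply hRP t ht
      by_contra hut
      have htu : t ≠ u := by rintro rfl; exact htS huS
      have hty : t ≠ y := by rintro rfl; exact htS h.2
      have := C.conv _ (hS _ huS) y t u h.1 ht huP (lt_of_le_of_ne hyt hty.symm)
        (lt_of_le_of_ne (not_lt.1 hut) htu) huT.2 (C.Arefl _)
      exact htS (desc _ huS _ this)
    · intro v hv hvy hns s t hs ht hsR
      by_contra htR
      have htR : R ≤ t := not_lt.1 htR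
      have hut : u < t := hR1.trans_le htR
      have hsu : s ≤ u := by
        by_contra hc
        exact absurd (hRP s hs.1 (not_le.1 hc)) (not_lt.2 hsR.le)
      have hys : y ≤ s := by
        by_contra hc
        have := hns s t hs ht (not_le.1 hc)
        linarith
      have hsy : s ≠ y := by rintro rfl; exact hvy hs
      have huv : C.A (C.lab u) v := by
        rcases eq_or_lt_of_le hsu with rfl | hsu
        · exact hs.2
        · exact C.conv v (hS v hv) s u t hs.1 huP ht.1 hsu hut hs.2 ht.2
      exact hvy ⟨h.1, C.Atrans _ _ _ huT.2 huv⟩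
  · obtain ⟨R, hR1, hR2⟩ := just_below (C.Pos ∪ P') y
    have hRP : ∀ t ∈ C.Pos, t < y → t < R := fun t ht => hR2 t (by simp [ht])
    refine ⟨R, fun hR => lt_irrefl _ (hRP R hR hR1), ?_, ?_, ?_, ?_⟩
    · intro x hx
      have c1 : x < y → x < R := hR2 x (by simp [hx])
      have c4 : x ≠ y := fun e => hy (e ▸ hx)
      grind
    · intro t ht hyt htS htT
      exact absurd ⟨htT.1, desc _ htS _ htT.2⟩ h
    · intro t ht hyt _
      exact hR1.trans_le hyt
    · intro v hv hvy hns s t hs ht hsR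
      exact hRP t ht.1 (hns s t hs ht (hsR.trans hR1))

theorem lemZ' (P' : Finset ℚ) (hS : ∀ v ∈ S, v ∉ C.Z) (desc : ∀ v ∈ S, ∀ x, C.A x v → x ∈ S)
    (hP' : ∀ x ∈ P', x ∉ C.Pos ∧ ∀ v ∈ S, C.nsep x v)
    (y : ℚ) (hy : y ∉ P') :
    ∃ R, R ∉ C.Pos ∧ (∀ x ∈ P', (x < y ↔ x < R) ∧ (y < x ↔ R < x)) ∧
      (∀ t ∈ C.Pos, t ≤ y → C.lab t ∈ S → C.T (C.lab t) y → R < t) ∧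
      (∀ t ∈ C.Pos, t ≤ y → C.lab t ∉ S → t < R) ∧
      (∀ v ∈ S, ¬ C.T v y → C.nsep y v → C.nsep R v) := by
  classical
  by_cases h : y ∈ C.Pos ∧ C.lab y ∈ S
  · obtain ⟨u, hu, hmin⟩ := Finset.exists_min_image
      (C.Pos.filter (fun t => t ≤ y ∧ C.lab t ∈ S ∧ C.T (C.lab t) y)) id
      ⟨y, by simp [h.1, h.2, C.T_self h.1]⟩
    simp only [Finset.mem_filter, id] at hu hmin
    obtain ⟨huP, hyu, huS, huT⟩ := hu
    obtain ⟨R, hR1, hR2⟩ := just_below (C.Pos ∪ P') u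
    have hRP : ∀ t ∈ C.Pos, t < u → t < R := fun t ht => hR2 t (by simp [ht])
    refine ⟨R, fun hR => lt_irrefl _ (hRP R hR hR1), ?_, ?_, ?_, ?_⟩
    · intro x hx
      have c1 : x < u → x < R := hR2 x (by simp [hx])
      have c2 : u ≠ x := fun e => (hP' x hx).1 (e ▸ huP)
      have c3 := (hP' x hx).2 _ huS u y (C.T_self huP) huT
      have c4 : x ≠ y := fun e => hy (e ▸ hx)
      grind
    · intro t ht hyt htS htT
      exact hR1.trans_le (hmin t ⟨ht, hyt, htS, htT⟩)
    · intro t ht hyt htS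
      apply hRP t ht
      by_contra hut
      have htu : t ≠ u := by rintro rfl; exact htS huS
      have hty : t ≠ y := by rintro rfl; exact htS h.2
      have := C.conv _ (hS _ huS) u t y huP ht h.1
        (lt_of_le_of_ne (not_lt.1 hut) htu.symm) (lt_of_le_of_ne hyt hty) (C.Arefl _) huT.2
      exact htS (desc _ huS _ this)
    · intro v hv hvy hns s t hs ht hsR
      by_contra htR
      have htR : R ≤ t := not_lt.1 htR
      have hsu : s < u := hsR.trans hR1
      have htu : u ≤ t := by
        by_contra hc
        exact absurd (hRP t ht.1 (not_le.1 hc)) (not_lt.2 htR)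
      have hty : t < y := by
        exact hns s t hs ht (hsu.trans_le hyu)
      have huv : C.A (C.lab u) v := by
        rcases eq_or_lt_of_le htu with rfl | htu
        · exact ht.2
        · exact C.conv v (hS v hv) s u t hs.1 huP ht.1 hsu htu hs.2 ht.2
      exact hvy ⟨h.1, C.Atrans _ _ _ huT.2 huv⟩
  · obtain ⟨R, hR1, hR2⟩ := just_above (C.Pos ∪ P') y
    have hRP : ∀ t ∈ C.Pos, y < t → R < t := fun t ht => hR2 t (by simp [ht])
    refine ⟨R, fun hR => lt_irrefl _ (hRP R hR hR1), ?_, ?_, ?_, ?_⟩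
    · intro x hx
      have c1 : y < x → R < x := hR2 x (by simp [hx])
      have c4 : x ≠ y := fun e => hy (e ▸ hx)
      grind
    · intro t ht hyt htS htT
      exact absurd ⟨htT.1, desc _ htS _ htT.2⟩ h
    · intro t ht hyt _
      exact hyt.trans_lt hR1
    · intro v hv hvy hns s t hs ht hsR
      have h1 : s < y := by
        by_contra hc
        have : s ≠ y := by rintro rfl; exact hvy hs
        exact absurd (hRP s hs.1 (lt_of_le_of_ne (not_lt.1 hc) this.symm)) (not_lt.2 hsR.le)
      exact (hns s t hs ht h1).trans hR1

end GPS


namespace GPS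

variable {V : Type} {C : Ctx V}
variable {α : List (Fin 3)} {S : Set V} {φ0 : V → W} {x1 x2 x3 : ℚ} {π : Fin 3 → Fin 3}

theorem suffix_uniq {k l : Fin 3} {α β : List (Fin 3)} (h1 : (k :: α) <:+ β) (h2 : (l :: α) <:+ β) :
    k = l := by
  rcases List.suffix_or_suffix_of_suffix h1 h2 with h | h
  · have := h.eq_of_length (by simp)
    simpa using this
  · have := h.eq_of_length (by simp)
    simpa using this.symm

theorem not_cons_suffix {k : Fin 3} {α : List (Fin 3)} (h : (k :: α) <:+ α) : False := by
  have := h.length_le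
  simp at this

theorem combine (Y : Set V) (S' : Fin 3 → Set V) (c : Fin 3 → Fin 3) (hc : Function.Injective c)
    (a : Fin 3 → V) (hYS : ∀ v ∈ Y, v ∈ S) (hS'S : ∀ k, ∀ v ∈ S' k, v ∈ S)
    (hYd : ∀ k, ∀ v ∈ S' k, v ∉ Y) (hd : ∀ k l v, v ∈ S' k → v ∈ S' l → k = l)
    (hcov : ∀ v ∈ S, v ∈ Y ∨ ∃ k, v ∈ S' k) (φ1 : V → W)
    (hφY : ∀ v ∈ Y, φ1 v = Sum.inr α) (hφ1 : ∀ v, v ∉ Y → φ1 v = φ0 v)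
    (hsol : ∀ k, Sol C (c k :: α) (S' k) φ1)
    (hed : ∀ k u w, u ∈ S' k → C.G.Adj u w → w ∈ S → w ∈ Y ∨ w ∈ S' k)
    (hYed : ∀ u w, u ∈ Y → C.G.Adj u w → w ∉ S → HR (Sum.inr α) (φ0 w))
    (ha : ∀ u ∈ Y, ∃ i, C.A (a i) u) : Sol C α S φ0 := by
  classical
  choose φk h1 h2 h3 h4 using hsol
  let φ : V → W := fun v => if h : ∃ k, v ∈ S' k then φk h.choose v else φ1 v
  have p1 : ∀ k v, v ∈ S' k → φ v = φk k v := by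
    intro k v hv
    have h : ∃ k, v ∈ S' k := ⟨k, hv⟩
    have e : h.choose = k := hd _ _ v h.choose_spec hv
    simp only [φ, dif_pos h]
    rw [e]
  have p2 : ∀ v, (∀ k, v ∉ S' k) → φ v = φ1 v := by
    intro v hv
    simp only [φ]
    rw [dif_neg (by rintro ⟨k, hk⟩; exact hv k hk)]
  have pY : ∀ v ∈ Y, φ v = Sum.inr α := by
    intro v hv
    rw [p2 v (fun k hk => hYd k v hk hv), hφY v hv]
  have pk : ∀ k u w, u ∈ S' k → C.G.Adj u w → φ u = φ w ∨ HR (φ u) (φ w) := by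
    intro k u w hu huw
    have : φ w = φk k w := by
      by_cases hw : w ∈ S' k
      · exact p1 k w hw
      · rw [h1 k w hw]
        apply p2
        intro l hl
        rcases hed k u w hu huw (hS'S l w hl) with h | h
        · exact hYd l w hl h
        · exact hw h
    rw [this, p1 k u hu]
    exact h3 k u hu w huw
  refine ⟨φ, ?_, ?_, ?_, ?_⟩
  · intro v hv
    rw [p2 v (fun k hk => hv (hS'S k v hk)), hφ1 v (fun h => hv (hYS v h))]
  · intro v hv
    rcases hcov v hv with h | ⟨k, h⟩
    · exact ⟨α, pY v h, List.suffix_refl _⟩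
    · obtain ⟨β, hb1, hb2⟩ := h2 k v h
      exact ⟨β, by rw [p1 k v h, hb1], (List.suffix_cons _ _).trans hb2⟩
  · intro u hu w huw
    rcases hcov u hu with h | ⟨k, h⟩
    · by_cases hw : w ∈ S
      · rcases hcov w hw with h' | ⟨k, h'⟩
        · left; rw [pY u h, pY w h']
        · rcases pk k w u h' huw.symm with e | e
          · exact Or.inl e.symm
          · exact Or.inr e.symm
      · right
        rw [pY u h, p2 w (fun k hk => hw (hS'S k w hk)), hφ1 w (fun h => hw (hYS w h))]
        exact hYed u w h huw hw
    · exact pk k u w h huw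
  · intro β
    by_cases hβ : β = α
    · subst hβ
      refine ⟨a, fun u hu hφ => ?_⟩
      rcases hcov u hu with h | ⟨k, h⟩
      · exact ha u h
      · obtain ⟨γ, hb1, hb2⟩ := h2 k u h
        rw [p1 k u h, hb1, Sum.inr.injEq] at hφ
        rw [hφ] at hb2
        exact (not_cons_suffix hb2).elim
    · by_cases hk : ∃ k, (c k :: α) <:+ β
      · obtain ⟨k, hk⟩ := hk
        obtain ⟨b, hb⟩ := h4 k β
        refine ⟨b, fun u hu hφ => ?_⟩
        rcases hcov u hu with h | ⟨l, h⟩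
        · rw [pY u h, Sum.inr.injEq] at hφ
          exact absurd hφ.symm hβ
        · obtain ⟨γ, hb1, hb2⟩ := h2 l u h
          rw [p1 l u h] at hφ
          have e := hφ
          rw [hb1, Sum.inr.injEq] at e
          rw [e] at hb2
          have := hc (suffix_uniq hb2 hk)
          subst this
          exact hb u h hφ
      · refine ⟨a, fun u hu hφ => ?_⟩
        rcases hcov u hu with h | ⟨l, h⟩
        · exact ha u h
        · obtain ⟨γ, hb1, hb2⟩ := h2 l u h
          rw [p1 l u h, hb1, Sum.inr.injEq] at hφ
          rw [hφ] at hb2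
          exact absurd ⟨l, hb2⟩ hk

theorem child (hR : Reg C α S φ0 x1 x2 x3 π) (Y : Set V) (φ1 : V → W)
    (hφY : ∀ v ∈ Y, φ1 v = Sum.inr α) (hφ1 : ∀ v, v ∉ Y → φ1 v = φ0 v)
    (hYS : ∀ v ∈ Y, v ∈ S) (hYup : ∀ v x, x ∈ Y → C.A x v → v ∈ S → v ∈ Y)
    (I cl : ℚ → Prop) (c d : Fin 3) (x1' x2' x3' : ℚ)
    (hI : ∀ v ∈ S, v ∉ Y → ∀ s t, C.T v s → C.T v t → I s → I t)
    (hG : ∀ i j, (C.N i j ∨ C.N j i) → C.lab i ∈ S → I i → cl j)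
    (hcl : ∀ j ∈ C.Pos, cl j → C.lab j ∈ S → C.lab j ∈ Y ∨ I j)
    (ha : ∀ j ∈ C.Pos, cl j → C.lab j ∈ Y → bi x1' x2' x3' j + d = c)
    (hb : ∀ j ∈ C.Pos, cl j → C.lab j ∉ S →
      bi x1' x2' x3' j + d = bi x1 x2 x3 j ∧ bi x1 x2 x3 j ≠ c)
    (lt12 : x1' < x2') (lt23 : x2' < x3') (n1 : x1' ∉ C.Pos) (n2 : x2' ∉ C.Pos) (n3 : x3' ∉ C.Pos)
    (m1 : ∀ v ∈ S, v ∉ Y → C.nsep x1' v) (m2 : ∀ v ∈ S, v ∉ Y → C.nsep x2' v)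
    (m3 : ∀ v ∈ S, v ∉ Y → C.nsep x3' v) :
    Reg C (π c :: α) {v | v ∈ S ∧ v ∉ Y ∧ ∃ t ∈ C.Pos, C.lab t = v ∧ I t} φ1 x1' x2' x3'
      (fun i => π (i + d)) where
  hS v hv := hR.hS v hv.1
  desc := by
    rintro v ⟨h1, h2, t, ht, rfl, hIt⟩ x hx
    have hxS := hR.desc _ h1 x hx
    refine ⟨hxS, fun h => h2 (hYup _ _ h hx h1), ?_⟩
    obtain ⟨s, hs, rfl⟩ := C.surj x
    exact ⟨s, hs, rfl, hI _ h1 h2 t s (C.T_self ht) ⟨hs, hx⟩ hIt⟩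
  lt12 := lt12
  lt23 := lt23
  n1 := n1
  n2 := n2
  n3 := n3
  inj := fun i j h => by simpa using hR.inj h
  r2 := by
    intro i j hN hi hj
    obtain ⟨h1, h2, t, ht, e, hIt⟩ := hi
    have hP : i ∈ C.Pos ∧ j ∈ C.Pos := by
      rcases hN with h | h
      · exact C.NP _ _ h
      · exact (C.NP _ _ h).symm
    have hIi : I i := hI _ h1 h2 t i ⟨ht, by rw [e]; exact C.Arefl _⟩ (C.T_self hP.1) hIt
    have hclj := hG i j hN h1 hIi
    by_cases hjS : C.lab j ∈ S
    · have hjY : C.lab j ∈ Y := by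
        by_contra hjY
        rcases hcl j hP.2 hclj hjS with h | h
        · exact hjY h
        · exact hj ⟨hjS, hjY, j, hP.2, rfl, h⟩
      rw [hφY _ hjY, ha j hP.2 hclj hjY]
      simp [crn]
    · obtain ⟨b1, b2⟩ := hb j hP.2 hclj hjS
      rw [hφ1 _ (fun h => hjS (hYS _ h)), b1, hR.r2 i j hN h1 hjS]
      have : π (bi x1 x2 x3 j) ≠ π c := fun h => b2 (hR.inj h)
      simp [crn, this]
  r31 v hv := m1 v hv.1 hv.2.1
  r32 v hv := m2 v hv.1 hv.2.1
  r33 v hv := m3 v hv.1 hv.2.1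

theorem exists_edge (v : V) (hv : v ∉ C.Z) : ∃ i j, C.N i j ∧ (C.lab i = v ∨ C.lab j = v) := by
  classical
  obtain ⟨t, ht, rfl⟩ := C.surj v
  obtain ⟨z, hz, hzZ⟩ := C.hZ
  have hne : t ≠ z := by rintro rfl; exact hv hzZ
  rcases lt_or_gt_of_ne hne with h | h
  · obtain ⟨k, hk, hmin⟩ := Finset.exists_min_image (C.Pos.filter (fun u => t < u)) id
      ⟨z, by simp [hz, h]⟩
    simp only [Finset.mem_filter, id] at hk hmin
    exact ⟨t, k, C.consec t k ht hk.1 hk.2 (fun u hu hh => absurd (hmin u ⟨hu, hh.1⟩) (not_le.2 hh.2)),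
      Or.inl rfl⟩
  · obtain ⟨k, hk, hmax⟩ := Finset.exists_max_image (C.Pos.filter (fun u => u < t)) id
      ⟨z, by simp [hz, h]⟩
    simp only [Finset.mem_filter, id] at hk hmax
    exact ⟨k, t, C.consec k t hk.1 ht hk.2 (fun u hu hh => absurd (hmax u ⟨hu, hh.2⟩) (not_le.2 hh.1)),
      Or.inr rfl⟩

end GPS


namespace GPS

theorem bi0 {x1 x2 x3 t : ℚ} (h : t < x1) : bi x1 x2 x3 t = 0 := by simp [bi, h]
theorem bi0' {x1 x2 x3 t : ℚ} (h1 : x1 < x2) (h2 : x2 < x3) (h : x3 < t) : bi x1 x2 x3 t = 0 := by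
  unfold bi; rw [if_neg (by linarith), if_neg (by linarith), if_neg (by linarith)]
theorem bi1 {x1 x2 x3 t : ℚ} (h1 : x1 < t) (h : t < x2) : bi x1 x2 x3 t = 1 := by
  unfold bi; rw [if_neg (by linarith), if_pos (by linarith)]
theorem bi2 {x1 x2 x3 t : ℚ} (h0 : x1 < x2) (h1 : x2 < t) (h : t < x3) : bi x1 x2 x3 t = 2 := by
  unfold bi; rw [if_neg (by linarith), if_neg (by linarith), if_pos (by linarith)]

def SG (x1 x2 x3 y j : ℚ) : Prop := (j < x1 ↔ y < x1) ∧ (j < x2 ↔ y < x2) ∧ (j < x3 ↔ y < x3)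

def YP (x1 x2 x3 y1 y2 y3 R1 R2 R3 L1 L2 L3 j : ℚ) : Prop :=
  (SG x1 x2 x3 y1 j ∧ (y1 ≤ j → j < R1) ∧ (j ≤ y1 → L1 < j)) ∨
  (SG x1 x2 x3 y2 j ∧ (y2 ≤ j → j < R2) ∧ (j ≤ y2 → L2 < j)) ∨
  (SG x1 x2 x3 y3 j ∧ (y3 ≤ j → j < R3) ∧ (j ≤ y3 → L3 < j))

theorem arcs_I {x1 x2 x3 y1 y2 y3 R1 R2 R3 L1 L2 L3 j : ℚ}
    (b : y1 < x1 ∧ x1 < y2 ∧ y2 < x2 ∧ x2 < y3 ∧ y3 < x3)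
    (f : R1 < x1 ∧ L1 < x1 ∧ x1 < R2 ∧ R2 < x2 ∧ x1 < L2 ∧ L2 < x2 ∧ x2 < R3 ∧ R3 < x3 ∧ x2 < L3 ∧ L3 < x3)
    (h : YP x1 x2 x3 y1 y2 y3 R1 R2 R3 L1 L2 L3 j) :
    (j ≤ y1 ∨ y3 ≤ j → L1 < j ∧ j < R3) ∧ (y1 ≤ j ∧ j ≤ y2 → j < R1 ∨ L2 < j) ∧
    (y2 ≤ j ∧ j ≤ y3 → j < R2 ∨ L3 < j) := by
  unfold YP SG at h
  grind

theorem arcs_II {x1 x2 x3 y1 y2 y3 R1 R2 R3 L1 L2 L3 j : ℚ}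
    (b : x1 < y1 ∧ y1 < x2 ∧ x2 < y2 ∧ y2 < x3 ∧ x3 < y3)
    (f : x1 < R1 ∧ R1 < x2 ∧ x1 < L1 ∧ L1 < x2 ∧ x2 < R2 ∧ R2 < x3 ∧ x2 < L2 ∧ L2 < x3 ∧ x3 < R3 ∧ x3 < L3)
    (h : YP x1 x2 x3 y1 y2 y3 R1 R2 R3 L1 L2 L3 j) :
    (j ≤ y1 ∨ y3 ≤ j → L1 < j ∧ j < R3) ∧ (y1 ≤ j ∧ j ≤ y2 → j < R1 ∨ L2 < j) ∧
    (y2 ≤ j ∧ j ≤ y3 → j < R2 ∨ L3 < j) := by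
  unfold YP SG at h
  grind

end GPS


namespace GPS

variable {V : Type} {C : Ctx V}

set_option maxHeartbeats 4000000 in
theorem step [Finite V] {α : List (Fin 3)} {S : Set V} {φ0 : V → W} {x1 x2 x3 : ℚ} {π : Fin 3 → Fin 3}
    (IH : ∀ (α' : List (Fin 3)) (S' : Set V) (φ' : V → W) (a1 a2 a3 : ℚ) (π' : Fin 3 → Fin 3),
      S'.ncard < S.ncard → Reg C α' S' φ' a1 a2 a3 π' → Sol C α' S' φ')
    (hR : Reg C α S φ0 x1 x2 x3 π) (hne : S.Nonempty) : Sol C α S φ0 := by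
  classical
  obtain ⟨y1, y2, y3, hty, hU, hgood⟩ := good_triple
    (fun i j => C.N i j ∧ (C.lab i ∈ S ∨ C.lab j ∈ S)) C.Pos {t | t ∈ C.Pos ∧ C.lab t ∈ S}
    (fun i j h => C.NP i j h.1) (fun i j h => C.Nlt i j h.1)
    (fun i j k l h h' => C.nc i j k l h.1 h'.1)
    (fun i j h => by
      have := C.NP i j h.1
      rcases h.2 with h2 | h2
      · exact Or.inl ⟨this.1, h2⟩
      · exact Or.inr ⟨this.2, h2⟩)
    (by
      obtain ⟨v, hv⟩ := hne
      obtain ⟨i, j, h1, h2⟩ := exists_edge (C := C) v (hR.hS v hv)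
      refine ⟨i, j, h1, ?_⟩
      rcases h2 with rfl | rfl
      · exact Or.inl hv
      · exact Or.inr hv)
    x1 x2 x3 hR.lt12 hR.lt23 hR.n1 hR.n2 hR.n3
  have hy12 : y1 < y2 := by rcases hty with h | h <;> linarith
  have hy23 : y2 < y3 := by rcases hty with h | h <;> linarith
  set Y : Set V := {v | v ∈ S ∧ (C.T v y1 ∨ C.T v y2 ∨ C.T v y3)} with hYdef
  have hYS : ∀ v ∈ Y, v ∈ S := fun v h => h.1
  have hYup : ∀ v x, x ∈ Y → C.A x v → v ∈ S → v ∈ Y := by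
    rintro v x ⟨_, h⟩ hxv hv
    refine ⟨hv, ?_⟩
    have aux : ∀ y, C.T x y → C.T v y := fun y h => ⟨h.1, C.Atrans _ _ _ h.2 hxv⟩
    rcases h with h | h | h
    · exact Or.inl (aux _ h)
    · exact Or.inr (Or.inl (aux _ h))
    · exact Or.inr (Or.inr (aux _ h))
  let φ1 : V → W := fun v => if v ∈ Y then Sum.inr α else φ0 v
  have hφY : ∀ v ∈ Y, φ1 v = Sum.inr α := fun v hv => by simp [φ1, hv]
  have hφ1 : ∀ v, v ∉ Y → φ1 v = φ0 v := fun v hv => by simp [φ1, hv]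
  have g1 : ∀ v ∈ S, ∀ s t, C.T v s → C.T v t → (s < x1 → t < x1) := fun v hv => hR.r31 v hv
  have g2 : ∀ v ∈ S, ∀ s t, C.T v s → C.T v t → (s < x2 → t < x2) := fun v hv => hR.r32 v hv
  have g3 : ∀ v ∈ S, ∀ s t, C.T v s → C.T v t → (s < x3 → t < x3) := fun v hv => hR.r33 v hv
  have nY : ∀ v ∈ S, v ∉ Y → ¬ C.T v y1 ∧ ¬ C.T v y2 ∧ ¬ C.T v y3 := by
    intro v hv hvY
    refine ⟨fun h => hvY ⟨hv, Or.inl h⟩, fun h => hvY ⟨hv, Or.inr (Or.inl h)⟩,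
      fun h => hvY ⟨hv, Or.inr (Or.inr h)⟩⟩
  have NS : ∀ y, (y = y1 ∨ y = y2 ∨ y = y3) → ∀ v ∈ S, v ∉ Y → C.nsep y v := by
    intro y hy v hv hvY s t hs ht hsy
    by_contra hty'
    obtain ⟨i, k, hN, hi, hk, hiy, hyk⟩ := straddle (hR.hS v hv) hs ht hsy (not_lt.1 hty')
    have hky : k ≠ y := by
      rintro rfl
      have := nY v hv hvY
      rcases hy with rfl | rfl | rfl <;> tauto
    have h1 := hgood i k ⟨hN, Or.inl (hR.desc _ hv _ hi.2)⟩
    have h2 := g1 v hv i k hi hk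
    have h3 := g2 v hv i k hi hk
    have h4 := g3 v hv i k hi hk
    have hyk' : y < k := lt_of_le_of_ne hyk (Ne.symm hky)
    clear IH hR hgood g1 g2 g3
    rcases hty with ⟨b1, b2, b3, b4, b5⟩ | ⟨b1, b2, b3, b4, b5⟩ <;>
    rcases hy with rfl | rfl | rfl <;>
    rcases h1 with h1 | h1 | ⟨h1 | h1, h1' | h1'⟩ <;>
    first
      | linarith
      | (have := h2 (by linarith); linarith)
      | (have := h3 (by linarith); linarith)
      | (have := h4 (by linarith); linarith)
  let I : Fin 3 → ℚ → Prop := ![fun t => t < y1 ∨ y3 < t, fun t => y1 < t ∧ t < y2, fun t => y2 < t ∧ t < y3]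
  let cl : Fin 3 → ℚ → Prop := ![fun t => t ≤ y1 ∨ y3 ≤ t, fun t => y1 ≤ t ∧ t ≤ y2, fun t => y2 ≤ t ∧ t ≤ y3]
  have hNy : ∀ v ∈ S, v ∉ Y → ∀ t, C.T v t → t ≠ y1 ∧ t ≠ y2 ∧ t ≠ y3 := by
    intro v hv hvY t ht
    have := nY v hv hvY
    refine ⟨?_, ?_, ?_⟩ <;> rintro rfl <;> tauto
  have hI : ∀ k, ∀ v ∈ S, v ∉ Y → ∀ s t, C.T v s → C.T v t → I k s → I k t := by
    intro k v hv hvY s t hs ht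
    have e1 := NS y1 (Or.inl rfl) v hv hvY
    have e2 := NS y2 (Or.inr (Or.inl rfl)) v hv hvY
    have e3 := NS y3 (Or.inr (Or.inr rfl)) v hv hvY
    have f1 := e1 s t hs ht
    have f2 := e2 s t hs ht
    have f3 := e3 s t hs ht
    have f1' := e1 t s ht hs
    have f2' := e2 t s ht hs
    have f3' := e3 t s ht hs
    have n1 := hNy v hv hvY t ht
    clear IH hR hgood g1 g2 g3 hty e1 e2 e3 NS
    fin_cases k <;> simp only [I] <;> intro h <;> simp at h ⊢ <;> grind
  have hcl : ∀ k, ∀ j ∈ C.Pos, cl k j → C.lab j ∈ S → C.lab j ∈ Y ∨ I k j := by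
    intro k j hj hcj hjS
    by_cases hjY : C.lab j ∈ Y
    · exact Or.inl hjY
    · right
      have n1 := hNy _ hjS hjY j (C.T_self hj)
      clear IH hR hgood g1 g2 g3 hty NS
      revert hcj
      fin_cases k <;> simp only [I, cl] <;> intro h <;> simp at h ⊢ <;> grind
  have hG : ∀ k i j, (C.N i j ∨ C.N j i) → C.lab i ∈ S → I k i → cl k j := by
    intro k i j hN hi
    have : (C.N i j ∧ GoodT (fun a b => a = i ∧ b = j) y1 y2 y3) ∨
        (C.N j i ∧ GoodT (fun a b => a = j ∧ b = i) y1 y2 y3) := by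
      rcases hN with h | h
      · left; refine ⟨h, ?_⟩; rintro a b ⟨rfl, rfl⟩; exact hgood _ _ ⟨h, Or.inl hi⟩
      · right; refine ⟨h, ?_⟩; rintro a b ⟨rfl, rfl⟩; exact hgood _ _ ⟨h, Or.inr hi⟩
    rcases this with ⟨h, h'⟩ | ⟨h, h'⟩
    · have h1 := h' _ _ ⟨rfl, rfl⟩
      have h2 := C.Nlt _ _ h
      clear IH hR hgood g1 g2 g3 hty NS h' hI hcl hN h
      fin_cases k <;> simp only [I, cl] <;> intro h <;> simp at h ⊢ <;> grind
    · have h1 := h' _ _ ⟨rfl, rfl⟩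
      have h2 := C.Nlt _ _ h
      clear IH hR hgood g1 g2 g3 hty NS h' hI hcl hN h
      fin_cases k <;> simp only [I, cl] <;> intro h <;> simp at h ⊢ <;> grind
  -- the auxiliary thresholds
  have hP' : ∀ x ∈ ({x1, x2, x3} : Finset ℚ), x ∉ C.Pos ∧ ∀ v ∈ S, C.nsep x v := by
    intro x hx
    simp only [Finset.mem_insert, Finset.mem_singleton] at hx
    rcases hx with rfl | rfl | rfl
    · exact ⟨hR.n1, hR.r31⟩
    · exact ⟨hR.n2, hR.r32⟩
    · exact ⟨hR.n3, hR.r33⟩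
  have hy1 : y1 ∉ ({x1, x2, x3} : Finset ℚ) := by
    simp only [Finset.mem_insert, Finset.mem_singleton]
    rcases hty with h | h <;> rintro (h' | h' | h') <;> linarith
  have hy2 : y2 ∉ ({x1, x2, x3} : Finset ℚ) := by
    simp only [Finset.mem_insert, Finset.mem_singleton]
    rcases hty with h | h <;> rintro (h' | h' | h') <;> linarith
  have hy3 : y3 ∉ ({x1, x2, x3} : Finset ℚ) := by
    simp only [Finset.mem_insert, Finset.mem_singleton]
    rcases hty with h | h <;> rintro (h' | h' | h') <;> linarith
  obtain ⟨R1, R1p, R1x, R1a, R1b, R1c⟩ := lemZ (C := C) (S := S) _ hR.hS hR.desc hP' y1 hy1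
  obtain ⟨R2, R2p, R2x, R2a, R2b, R2c⟩ := lemZ (C := C) (S := S) _ hR.hS hR.desc hP' y2 hy2
  obtain ⟨R3, R3p, R3x, R3a, R3b, R3c⟩ := lemZ (C := C) (S := S) _ hR.hS hR.desc hP' y3 hy3
  obtain ⟨L1, L1p, L1x, L1a, L1b, L1c⟩ := lemZ' (C := C) (S := S) _ hR.hS hR.desc hP' y1 hy1
  obtain ⟨L2, L2p, L2x, L2a, L2b, L2c⟩ := lemZ' (C := C) (S := S) _ hR.hS hR.desc hP' y2 hy2
  obtain ⟨L3, L3p, L3x, L3a, L3b, L3c⟩ := lemZ' (C := C) (S := S) _ hR.hS hR.desc hP' y3 hy3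
  simp only [Finset.mem_insert, Finset.mem_singleton, forall_eq_or_imp, forall_eq] at R1x R2x R3x L1x L2x L3x
  have q1 : ∀ v ∈ S, v ∉ Y → C.nsep R1 v := fun v hv h => R1c v hv (nY v hv h).1 (NS _ (by simp) v hv h)
  have q2 : ∀ v ∈ S, v ∉ Y → C.nsep R2 v := fun v hv h => R2c v hv (nY v hv h).2.1 (NS _ (by simp) v hv h)
  have q3 : ∀ v ∈ S, v ∉ Y → C.nsep R3 v := fun v hv h => R3c v hv (nY v hv h).2.2 (NS _ (by simp) v hv h)
  have r1 : ∀ v ∈ S, v ∉ Y → C.nsep L1 v := fun v hv h => L1c v hv (nY v hv h).1 (NS _ (by simp) v hv h)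
  have r2 : ∀ v ∈ S, v ∉ Y → C.nsep L2 v := fun v hv h => L2c v hv (nY v hv h).2.1 (NS _ (by simp) v hv h)
  have r3 : ∀ v ∈ S, v ∉ Y → C.nsep L3 v := fun v hv h => L3c v hv (nY v hv h).2.2 (NS _ (by simp) v hv h)
  have o1 : ∀ v ∈ S, v ∉ Y → C.nsep x1 v := fun v hv _ => hR.r31 v hv
  have o2 : ∀ v ∈ S, v ∉ Y → C.nsep x2 v := fun v hv _ => hR.r32 v hv
  have o3 : ∀ v ∈ S, v ∉ Y → C.nsep x3 v := fun v hv _ => hR.r33 v hv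
  -- positions labelled in Y
  have hYpos : ∀ j ∈ C.Pos, C.lab j ∈ Y → YP x1 x2 x3 y1 y2 y3 R1 R2 R3 L1 L2 L3 j := by
    rintro j hj ⟨hjS, h⟩
    have hTj := C.T_self hj
    have hsg : ∀ y, C.T (C.lab j) y → SG x1 x2 x3 y j := fun y hT =>
      ⟨⟨g1 _ hjS _ _ hTj hT, g1 _ hjS _ _ hT hTj⟩, ⟨g2 _ hjS _ _ hTj hT, g2 _ hjS _ _ hT hTj⟩,
      ⟨g3 _ hjS _ _ hTj hT, g3 _ hjS _ _ hT hTj⟩⟩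
    rcases h with hT | hT | hT
    · exact Or.inl ⟨hsg _ hT, fun h => R1a j hj h hjS hT, fun h => L1a j hj h hjS hT⟩
    · exact Or.inr (Or.inl ⟨hsg _ hT, fun h => R2a j hj h hjS hT, fun h => L2a j hj h hjS hT⟩)
    · exact Or.inr (Or.inr ⟨hsg _ hT, fun h => R3a j hj h hjS hT, fun h => L3a j hj h hjS hT⟩)
  have hxj : ∀ j ∈ C.Pos, j ≠ x1 ∧ j ≠ x2 ∧ j ≠ x3 := by
    intro j hj
    refine ⟨?_, ?_, ?_⟩ <;> rintro rfl
    · exact hR.n1 hj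
    · exact hR.n2 hj
    · exact hR.n3 hj
  have main : ∃ c0 : Fin 3 → Fin 3, Function.Injective c0 ∧ ∀ k, ∃ a1 a2 a3 π',
      Reg C (π (c0 k) :: α) {v | v ∈ S ∧ v ∉ Y ∧ ∃ t ∈ C.Pos, C.lab t = v ∧ I k t} φ1 a1 a2 a3 π' := by
    have hx12 := hR.lt12
    have hx23 := hR.lt23
    rcases hty with b | b
    · have f : R1 < x1 ∧ L1 < x1 ∧ x1 < R2 ∧ R2 < x2 ∧ x1 < L2 ∧ L2 < x2 ∧ x2 < R3 ∧ R3 < x3 ∧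
          x2 < L3 ∧ L3 < x3 :=
        ⟨R1x.1.2.1 b.1, L1x.1.2.1 b.1, R2x.1.1.1 b.2.1, R2x.2.1.2.1 b.2.2.1, L2x.1.1.1 b.2.1,
          L2x.2.1.2.1 b.2.2.1, R3x.2.1.1.1 b.2.2.2.1, R3x.2.2.2.1 b.2.2.2.2, L3x.2.1.1.1 b.2.2.2.1,
          L3x.2.2.2.1 b.2.2.2.2⟩
      have hA := fun j hj hY => arcs_I b f (hYpos j hj hY)
      obtain ⟨b1, b2, b3, b4, b5⟩ := b
      obtain ⟨f1, f2, f3, f4, f5, f6, f7, f8, f9, f10⟩ := f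
      refine ⟨![1, 2, 0], by decide, ?_⟩
      intro k
      match k with
      | 0 =>
        refine ⟨L1, R3, x3, _, child hR Y φ1 hφY hφ1 hYS hYup (I 0) (cl 0) 1 0 L1 R3 x3 (hI 0) (hG 0)
          (hcl 0) ?_ ?_ (by linarith) (by linarith) L1p R3p hR.n3 r1 q3 o3⟩
        · intro j hj hc hY
          have := (hA j hj hY).1 hc
          rw [bi1 this.1 this.2]; rfl
        · intro j hj hc hS
          rcases hc with hc | hc
          · have := L1b j hj hc hS
            rw [bi0 this, bi0 (by linarith : j < x1)]; decide
          · have := R3b j hj hc hS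
            rcases lt_or_gt_of_ne (hxj j hj).2.2 with h | h
            · rw [bi2 (by linarith) this h, bi2 hx12 (by linarith) h]; decide
            · rw [bi0' (by linarith) (by linarith) h, bi0' hx12 hx23 h]; decide
      | 1 =>
        refine ⟨R1, x1, L2, _, child hR Y φ1 hφY hφ1 hYS hYup (I 1) (cl 1) 2 2 R1 x1 L2 (hI 1) (hG 1)
          (hcl 1) ?_ ?_ (by linarith) (by linarith) R1p hR.n1 L2p q1 o1 r2⟩
        · intro j hj hc hY
          rcases (hA j hj hY).2.1 hc with h | h
          · rw [bi0 h]; rfl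
          · rw [bi0' (by linarith) (by linarith) h]; rfl
        · intro j hj hc hS
          have h1 := R1b j hj hc.1 hS
          have h2 := L2b j hj hc.2 hS
          rcases lt_or_gt_of_ne (hxj j hj).1 with h | h
          · rw [bi1 h1 h, bi0 h]; decide
          · rw [bi2 (by linarith) h h2, bi1 h (by linarith)]; decide
      | 2 =>
        refine ⟨R2, x2, L3, _, child hR Y φ1 hφY hφ1 hYS hYup (I 2) (cl 2) 0 0 R2 x2 L3 (hI 2) (hG 2)
          (hcl 2) ?_ ?_ (by linarith) (by linarith) R2p hR.n2 L3p q2 o2 r3⟩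
        · intro j hj hc hY
          rcases (hA j hj hY).2.2 hc with h | h
          · rw [bi0 h]; rfl
          · rw [bi0' (by linarith) (by linarith) h]; rfl
        · intro j hj hc hS
          have h1 := R2b j hj hc.1 hS
          have h2 := L3b j hj hc.2 hS
          rcases lt_or_gt_of_ne (hxj j hj).2.1 with h | h
          · rw [bi1 h1 h, bi1 (by linarith) h]; decide
          · rw [bi2 (by linarith) h h2, bi2 hx12 h (by linarith)]; decide
    · have f : x1 < R1 ∧ R1 < x2 ∧ x1 < L1 ∧ L1 < x2 ∧ x2 < R2 ∧ R2 < x3 ∧ x2 < L2 ∧ L2 < x3 ∧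
          x3 < R3 ∧ x3 < L3 :=
        ⟨R1x.1.1.1 b.1, R1x.2.1.2.1 b.2.1, L1x.1.1.1 b.1, L1x.2.1.2.1 b.2.1, R2x.2.1.1.1 b.2.2.1,
          R2x.2.2.2.1 b.2.2.2.1, L2x.2.1.1.1 b.2.2.1, L2x.2.2.2.1 b.2.2.2.1, R3x.2.2.1.1 b.2.2.2.2,
          L3x.2.2.1.1 b.2.2.2.2⟩
      have hA := fun j hj hY => arcs_II b f (hYpos j hj hY)
      obtain ⟨b1, b2, b3, b4, b5⟩ := b
      obtain ⟨f1, f2, f3, f4, f5, f6, f7, f8, f9, f10⟩ := f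
      refine ⟨![2, 0, 1], by decide, ?_⟩
      intro k
      match k with
      | 0 =>
        refine ⟨x1, L1, R3, _, child hR Y φ1 hφY hφ1 hYS hYup (I 0) (cl 0) 2 0 x1 L1 R3 (hI 0) (hG 0)
          (hcl 0) ?_ ?_ (by linarith) (by linarith) hR.n1 L1p R3p o1 r1 q3⟩
        · intro j hj hc hY
          have := (hA j hj hY).1 hc
          rw [bi2 (by linarith) this.1 this.2]; rfl
        · intro j hj hc hS
          rcases hc with hc | hc
          · have := L1b j hj hc hS
            rcases lt_or_gt_of_ne (hxj j hj).1 with h | h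
            · rw [bi0 h, bi0 h]; decide
            · rw [bi1 h this, bi1 h (by linarith)]; decide
          · have := R3b j hj hc hS
            rw [bi0' (by linarith) (by linarith) this, bi0' hx12 hx23 (by linarith)]; decide
      | 1 =>
        refine ⟨R1, x2, L2, _, child hR Y φ1 hφY hφ1 hYS hYup (I 1) (cl 1) 0 0 R1 x2 L2 (hI 1) (hG 1)
          (hcl 1) ?_ ?_ (by linarith) (by linarith) R1p hR.n2 L2p q1 o2 r2⟩
        · intro j hj hc hY
          rcases (hA j hj hY).2.1 hc with h | h
          · rw [bi0 h]; rfl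
          · rw [bi0' (by linarith) (by linarith) h]; rfl
        · intro j hj hc hS
          have h1 := R1b j hj hc.1 hS
          have h2 := L2b j hj hc.2 hS
          rcases lt_or_gt_of_ne (hxj j hj).2.1 with h | h
          · rw [bi1 h1 h, bi1 (by linarith) h]; decide
          · rw [bi2 (by linarith) h h2, bi2 hx12 h (by linarith)]; decide
      | 2 =>
        refine ⟨R2, x3, L3, _, child hR Y φ1 hφY hφ1 hYS hYup (I 2) (cl 2) 1 1 R2 x3 L3 (hI 2) (hG 2)
          (hcl 2) ?_ ?_ (by linarith) (by linarith) R2p hR.n3 L3p q2 o3 r3⟩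
        · intro j hj hc hY
          rcases (hA j hj hY).2.2 hc with h | h
          · rw [bi0 h]; rfl
          · rw [bi0' (by linarith) (by linarith) h]; rfl
        · intro j hj hc hS
          have h1 := R2b j hj hc.1 hS
          have h2 := L3b j hj hc.2 hS
          rcases lt_or_gt_of_ne (hxj j hj).2.2 with h | h
          · rw [bi1 h1 h, bi2 hx12 (by linarith) h]; decide
          · rw [bi2 (by linarith) h h2, bi0' hx12 hx23 h]; decide
  obtain ⟨c0, hc0, hreg⟩ := main
  refine combine Y (fun k => {v | v ∈ S ∧ v ∉ Y ∧ ∃ t ∈ C.Pos, C.lab t = v ∧ I k t})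
    (fun k => π (c0 k)) (fun i j h => hc0 (hR.inj h)) ![C.lab y1, C.lab y2, C.lab y3]
    hYS (fun k v hv => hv.1) (fun k v hv => hv.2.1) ?_ ?_ φ1 hφY hφ1 ?_ ?_ ?_ ?_
  · rintro k l v ⟨h1, h2, t, ht, rfl, hIt⟩ ⟨-, -, t', ht', e, hIt'⟩
    have := hI k _ h1 h2 t t' (C.T_self ht) ⟨ht', by rw [e]; exact C.Arefl _⟩ hIt
    clear IH hR hgood g1 g2 g3 hty NS R1x R2x R3x L1x L2x L3x
    revert this hIt'
    fin_cases k <;> fin_cases l <;> simp [I] <;> grind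
  · intro v hv
    by_cases hvY : v ∈ Y
    · exact Or.inl hvY
    · right
      obtain ⟨t, ht, rfl⟩ := C.surj v
      have n1 := hNy _ hv hvY t (C.T_self ht)
      have : ∃ k, I k t := by
        by_cases ha : t < y1 ∨ y3 < t
        · exact ⟨0, ha⟩
        by_cases hb : t < y2
        · refine ⟨1, ?_, hb⟩
          rw [not_or, not_lt] at ha
          exact lt_of_le_of_ne ha.1 n1.1.symm
        · refine ⟨2, ?_, ?_⟩
          · exact lt_of_le_of_ne (not_lt.1 hb) n1.2.1.symm
          · rw [not_or, not_lt, not_lt] at ha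
            exact lt_of_le_of_ne ha.2 n1.2.2
      obtain ⟨k, hk⟩ := this
      exact ⟨k, hv, hvY, t, ht, rfl, hk⟩
  · intro k
    obtain ⟨a1, a2, a3, π', h⟩ := hreg k
    refine IH _ _ _ a1 a2 a3 π' ?_ h
    refine Set.ncard_lt_ncard ?_ (Set.toFinite _)
    refine ⟨fun v hv => hv.1, fun hsub => ?_⟩
    obtain ⟨y, hyU, hy⟩ : ∃ y, (y ∈ C.Pos ∧ C.lab y ∈ S) ∧ (y = y1 ∨ y = y2 ∨ y = y3) := by
      rcases hU with h | h | h
      · exact ⟨_, h, Or.inl rfl⟩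
      · exact ⟨_, h, Or.inr (Or.inl rfl)⟩
      · exact ⟨_, h, Or.inr (Or.inr rfl)⟩
    have h1 := (hsub hyU.2).2.1
    have h2 := hNy _ hyU.2 h1 y (C.T_self hyU.1)
    tauto
  · rintro k u w ⟨h1, h2, t, ht, e, hIt⟩ huw hw
    obtain ⟨i, j, hN, rfl, rfl⟩ := C.adj u w huw
    have hP : i ∈ C.Pos ∧ j ∈ C.Pos := by
      rcases hN with h | h
      · exact C.NP _ _ h
      · exact (C.NP _ _ h).symm
    have hIi : I k i := hI k _ h1 h2 t i ⟨ht, by rw [e]; exact C.Arefl _⟩ (C.T_self hP.1) hIt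
    have hclj := hG k i j hN h1 hIi
    by_cases hjY : C.lab j ∈ Y
    · exact Or.inl hjY
    · right
      rcases hcl k j hP.2 hclj hw with h | h
      · exact absurd h hjY
      · exact ⟨hw, hjY, j, hP.2, rfl, h⟩
  · intro u w hu huw hw
    obtain ⟨i, j, hN, rfl, rfl⟩ := C.adj u w huw
    exact ⟨α, _, Or.inl ⟨rfl, hR.r2 i j hN hu.1 hw⟩⟩
  · rintro u ⟨-, h | h | h⟩
    · exact ⟨0, h.2⟩
    · exact ⟨1, h.2⟩
    · exact ⟨2, h.2⟩

theorem solve [Finite V] (n : ℕ) : ∀ {α : List (Fin 3)} {S : Set V} {φ0 : V → W} {x1 x2 x3 : ℚ}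
    {π : Fin 3 → Fin 3}, S.ncard = n → Reg C α S φ0 x1 x2 x3 π → Sol C α S φ0 := by
  induction n using Nat.strong_induction_on with
  | _ n ih =>
    intro α S φ0 x1 x2 x3 π hn hR
    rcases S.eq_empty_or_nonempty with rfl | hne
    · obtain ⟨t, -, -⟩ := C.hZ
      exact ⟨φ0, fun _ _ => rfl, by simp, by simp, fun β => ⟨fun _ => C.lab t, by simp⟩⟩
    · refine step ?_ hR hne
      intro α' S' φ' a1 a2 a3 π' hlt hreg
      exact ih _ (hn ▸ hlt) rfl hreg

end GPS


namespace GPS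

variable {V E F : Type}

structure RT (M : Multigraph V E) (r : V) where
  par : V → V
  te : V → E
  dep : V → ℕ
  parr : par r = r
  tend : ∀ v, v ≠ r → M.ends (te v) = s(v, par v)
  dpar : ∀ v, v ≠ r → dep v = dep (par v) + 1
  dedge : ∀ u w, M.simple.Adj u w → dep u ≤ dep w + 1

theorem rt_exists (M : Multigraph V E) (r : V) (hc : M.simple.Connected) (e0 : E) :
    Nonempty (RT M r) := by
  classical
  have h : ∀ v, v ≠ r → ∃ w, M.simple.Adj v w ∧ M.simple.dist r v = M.simple.dist r w + 1 := by
    intro v hv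
    obtain ⟨p, hp⟩ := hc.exists_walk_length_eq_dist v r
    cases p with
    | nil => exact absurd rfl hv
    | cons hadj q =>
      rename_i w
      refine ⟨w, hadj, ?_⟩
      have h1 : M.simple.dist w r ≤ q.length := SimpleGraph.dist_le q
      have h2 : M.simple.dist v r ≤ M.simple.dist w r + 1 := by
        obtain ⟨q', hq'⟩ := hc.exists_walk_length_eq_dist w r
        have := SimpleGraph.dist_le (SimpleGraph.Walk.cons hadj q')
        simp at this
        omega
      simp at hp
      rw [SimpleGraph.dist_comm (u := r), SimpleGraph.dist_comm (u := r)]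
      omega
  have h' : ∀ v, ∃ w e, v ≠ r → M.ends e = s(v, w) ∧ M.simple.dist r v = M.simple.dist r w + 1 := by
    intro v
    by_cases hv : v = r
    · exact ⟨v, e0, fun h => absurd hv h⟩
    · obtain ⟨w, ⟨_, e, he⟩, hw⟩ := h v hv
      exact ⟨w, e, fun _ => ⟨he, hw⟩⟩
  choose p t hpt using h'
  refine ⟨⟨fun v => if v = r then r else p v, t, fun v => M.simple.dist r v, by simp, ?_, ?_, ?_⟩⟩
  · intro v hv; simp [hv, (hpt v hv).1]
  · intro v hv; simp only [hv, if_false]; exact (hpt v hv).2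
  · intro u w huw
    obtain ⟨q', hq'⟩ := hc.exists_walk_length_eq_dist w r
    have := SimpleGraph.dist_le (SimpleGraph.Walk.cons huw q')
    simp at this
    rw [SimpleGraph.dist_comm (u := r), SimpleGraph.dist_comm (u := r)]
    omega

namespace RT
variable {M : Multigraph V E} {r : V} (R : RT M r)

def A (x v : V) : Prop := ∃ k, R.par^[k] x = v

theorem A_refl (x : V) : R.A x x := ⟨0, rfl⟩
theorem A_trans {x y z : V} (h : R.A x y) (h' : R.A y z) : R.A x z := by
  obtain ⟨k, rfl⟩ := h
  obtain ⟨l, rfl⟩ := h'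
  exact ⟨l + k, Function.iterate_add_apply _ _ _ _⟩
theorem A_root (v : V) (h : R.A r v) : v = r := by
  obtain ⟨k, rfl⟩ := h
  exact Function.iterate_fixed R.parr k
theorem A_par (w v : V) : R.A w v ↔ w = v ∨ R.A (R.par w) v := by
  constructor
  · rintro ⟨k, hk⟩
    cases k with
    | zero => exact Or.inl hk
    | succ k => exact Or.inr ⟨k, by rwa [Function.iterate_succ_apply] at hk⟩
  · rintro (rfl | ⟨k, hk⟩)
    · exact R.A_refl _
    · exact ⟨k + 1, by rwa [Function.iterate_succ_apply]⟩
theorem A_to_root (v : V) : R.A v r := by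
  have : ∀ n v, R.dep v = n → R.A v r := by
    intro n
    induction n using Nat.strong_induction_on with
    | _ n ih =>
      intro v hv
      by_cases h : v = r
      · subst h; exact R.A_refl _
      · have := R.dpar v h
        exact (R.A_par _ _).2 (Or.inr (ih _ (by omega) _ rfl))
  exact this _ v rfl

/-- ancestors at the same depth coincide -/
theorem A_dep (x u v : V) (hu : R.A x u) (hv : R.A x v) (h : R.dep u = R.dep v) : u = v := by
  have key : ∀ (k : ℕ) (y : V), R.dep (R.par^[k] y) = R.dep y → R.par^[k] y = y := by
    intro k
    have mono : ∀ y, R.dep (R.par^[k] y) ≤ R.dep y := by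
      induction k with
      | zero => intro y; exact le_rfl
      | succ k ih =>
        intro y
        rw [Function.iterate_succ_apply]
        refine (ih _).trans ?_
        by_cases h : y = r
        · rw [h, R.parr]
        · have := R.dpar y h; omega
    cases k with
    | zero => intro y _; rfl
    | succ k =>
      intro y hy
      by_cases h : y = r
      · subst h; exact Function.iterate_fixed R.parr _
      · exfalso
        have m2 : ∀ z, R.dep (R.par^[k] z) ≤ R.dep z := by
          clear hy mono h
          induction k with
          | zero => intro y; exact le_rfl
          | succ k ih =>
            intro y
            rw [Function.iterate_succ_apply]
            refine (ih _).trans ?_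
            by_cases h : y = r
            · rw [h, R.parr]
            · have := R.dpar y h; omega
        rw [Function.iterate_succ_apply] at hy
        have := m2 (R.par y)
        have := R.dpar y h
        omega
  obtain ⟨k, rfl⟩ := hu
  obtain ⟨l, rfl⟩ := hv
  rcases le_total k l with hkl | hkl
  · obtain ⟨m, rfl⟩ := Nat.exists_eq_add_of_le' hkl
    rw [Function.iterate_add_apply] at h ⊢
    exact (key _ _ h.symm).symm
  · obtain ⟨m, rfl⟩ := Nat.exists_eq_add_of_le' hkl
    rw [Function.iterate_add_apply] at h ⊢
    exact key _ _ h

theorem te_inj (v w : V) (hv : v ≠ r) (hw : w ≠ r) (h : R.te v = R.te w) : v = w := by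
  have h1 := R.tend v hv
  rw [h, R.tend w hw] at h1
  rcases Sym2.eq_iff.1 h1 with h | h
  · exact h.1.symm
  · have a := R.dpar v hv
    have b := R.dpar w hw
    rw [← h.1] at a; rw [h.2] at b; omega

theorem flip (w v x y : V) (hw : w ≠ r) (hwv : w ≠ v) (h : M.ends (R.te w) = s(x, y)) :
    R.A x v ↔ R.A y v := by
  rw [R.tend w hw] at h
  have := R.A_par w v
  simp only [hwv, false_or] at this
  rcases Sym2.eq_iff.1 h with ⟨rfl, rfl⟩ | ⟨rfl, rfl⟩
  · exact this
  · exact this.symm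

def T : Set E := {e | ∃ v, v ≠ r ∧ R.te v = e}

end RT

open Classical in
noncomputable def occ {M : Multigraph V E} (W : M.CWalk) (e : E) : ℕ :=
  ∑ k ∈ Finset.range W.len, if W.edge k = e then 1 else 0

theorem occ_pos {M : Multigraph V E} (W : M.CWalk) (e : E) (k : ℕ) (hk : k < W.len) (h : W.edge k = e) :
    0 < occ W e := by
  unfold occ
  exact Finset.sum_pos' (fun _ _ => Nat.zero_le _) ⟨k, Finset.mem_range.2 hk, by simp [h]⟩

theorem occ_total [Fintype F] {M : Multigraph V E} (emb : M.Embedding F) (e : E) :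
    ∑ f, occ (emb.boundary f) e = 2 := by
  classical
  have h := emb.edge_twice e
  have h2 : {p : F × ℕ | Multigraph.IsOcc emb.boundary e p} =
    ((Finset.univ.sigma (fun f => (Finset.range (emb.boundary f).len).filter
      (fun k => (emb.boundary f).edge k = e))).map (Equiv.sigmaEquivProd F ℕ).toEmbedding : Finset (F × ℕ)) := by
    ext ⟨f, k⟩
    simp [Multigraph.IsOcc]
  rw [h2, Set.ncard_coe_finset, Finset.card_map, Finset.card_sigma] at h
  rw [← h]
  apply Finset.sum_congr rfl
  intro f _
  unfold occ
  rw [Finset.card_filter]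

theorem dual_conn [Fintype F] [Fintype E] {M : Multigraph V E} (emb : M.Embedding F) {r : V} (R : RT M r)
    (S : Finset F) (hS : S.Nonempty) (hS' : ∃ f, f ∉ S) :
    ∃ e, e ∉ R.T ∧ ∑ f ∈ S, occ (emb.boundary f) e = 1 := by
  classical
  by_contra hcon
  push Not at hcon
  have hsplit : ∀ e, ∑ f ∈ S, occ (emb.boundary f) e + ∑ f ∈ Sᶜ, occ (emb.boundary f) e = 2 := by
    intro e
    rw [Finset.sum_add_sum_compl]; exact occ_total emb e
  set m : E → ℕ := fun e => ∑ f ∈ S, occ (emb.boundary f) e with hm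
  have hT : ∀ e, m e ≠ 1 := by
    intro e
    by_cases he : e ∈ R.T
    swap
    · exact hcon e he
    obtain ⟨v, hv, rfl⟩ := he
    let h : V → ZMod 2 := fun x => if R.A x v then 1 else 0
    let δ : E → ZMod 2 := fun e => Sym2.lift ⟨fun x y => h x + h y, fun x y => add_comm _ _⟩ (M.ends e)
    have h1 : ∀ f, ∑ k ∈ Finset.range (emb.boundary f).len, δ ((emb.boundary f).edge k) = 0 := by
      intro f
      have : ∀ k, δ ((emb.boundary f).edge k) = h ((emb.boundary f).vtx (k+1)) - h ((emb.boundary f).vtx k) := by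
        intro k
        simp only [δ, (emb.boundary f).compat k, Sym2.lift_mk]
        rw [CharTwo.sub_eq_add, add_comm]
      simp only [this]
      rw [Finset.sum_range_sub (fun k => h ((emb.boundary f).vtx k))]
      have := (emb.boundary f).vtx_per 0
      rw [zero_add] at this
      rw [this, sub_self]
    have h2 : ∑ e, (m e : ZMod 2) * δ e = 0 := by
      simp only [hm, occ, Nat.cast_sum, Finset.sum_mul]
      rw [Finset.sum_comm]
      apply Finset.sum_eq_zero
      intro f _
      rw [Finset.sum_comm, ← h1 f]
      apply Finset.sum_congr rfl
      intro k _
      simp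
    have h3 : ∀ e, e ≠ R.te v → (m e : ZMod 2) * δ e = 0 := by
      intro e hev
      by_cases he : e ∈ R.T
      · obtain ⟨w, hw, rfl⟩ := he
        have hwv : w ≠ v := fun hh => hev (by rw [hh])
        have : δ (R.te w) = 0 := by
          have := R.flip w v w (R.par w) hw hwv (R.tend w hw)
          simp only [δ, R.tend w hw, Sym2.lift_mk, h, this]
          split_ifs <;> decide
        rw [this, mul_zero]
      · have a := hcon e he
        have b := hsplit e
        have : m e = 0 ∨ m e = 2 := by simp only [hm] at *; omega
        rcases this with h | h <;> rw [h]
        · simp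
        · rw [show ((2:ℕ) : ZMod 2) = 0 from rfl, zero_mul]
    rw [Finset.sum_eq_single (R.te v) (fun e _ he => h3 e he) (by simp)] at h2
    have h4 : δ (R.te v) = 1 := by
      simp only [δ, R.tend v hv, Sym2.lift_mk, h, R.A_refl, if_true]
      have : ¬ R.A (R.par v) v := by
        intro hA
        have hd := R.dpar v hv
        have key : ∀ (k : ℕ) (y : V), R.dep (R.par^[k] y) ≤ R.dep y := by
          intro k
          induction k with
          | zero => intro y; exact le_rfl
          | succ k ih =>
            intro y
            rw [Function.iterate_succ_apply]
            refine (ih _).trans ?_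
            by_cases h : y = r
            · rw [h, R.parr]
            · have := R.dpar y h; omega
        obtain ⟨k, hk⟩ := hA
        have := key k (R.par v)
        rw [hk] at this
        omega
      simp [this]
    intro h5
    rw [h4, h5] at h2
    exact absurd h2 (by decide)
  -- occurrences are all inside or all outside
  have hocc : ∀ e (p p' : F × ℕ), Multigraph.IsOcc emb.boundary e p → Multigraph.IsOcc emb.boundary e p' →
      p.1 ∈ S → p'.1 ∈ S := by
    intro e p p' hp hp' hpS
    by_contra hp'S
    have a := hsplit e
    have b := hT e
    have c : 0 < m e := Finset.sum_pos' (fun _ _ => Nat.zero_le _) ⟨p.1, hpS, occ_pos _ _ _ hp.1 hp.2⟩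
    have d : 0 < ∑ f ∈ Sᶜ, occ (emb.boundary f) e :=
      Finset.sum_pos' (fun _ _ => Nat.zero_le _) ⟨p'.1, by simpa using hp'S, occ_pos _ _ _ hp'.1 hp'.2⟩
    simp only [hm] at *
    omega
  have hlink : ∀ v c c', Relation.EqvGen (Multigraph.CornerLinked emb.boundary v) c c' → (c.1 ∈ S ↔ c'.1 ∈ S) := by
    intro v c c' h
    induction h with
    | rel c c' h =>
      obtain ⟨_, _, e, p, p', _, h1, h2, h3, h4⟩ := h
      rw [h3.1, h4.1]
      exact ⟨hocc e p p' h1 h2, hocc e p' p h2 h1⟩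
    | refl => exact Iff.rfl
    | symm _ _ _ ih => exact ih.symm
    | trans _ _ _ _ _ ih1 ih2 => exact ih1.trans ih2
  have hcor : ∀ f k, ∃ k', Multigraph.IsCorner emb.boundary ((emb.boundary f).vtx k) (f, k') := by
    intro f k
    refine ⟨k % (emb.boundary f).len, Nat.mod_lt _ (emb.boundary f).len_pos, ?_⟩
    exact (Function.Periodic.map_mod_nat (f := (emb.boundary f).vtx) (emb.boundary f).vtx_per k)
  let P : V → Prop := fun v => ∃ c, Multigraph.IsCorner emb.boundary v c ∧ c.1 ∈ S
  have hstep : ∀ u v, M.simple.Adj u v → P u → P v := by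
    rintro u v ⟨_, e, he⟩ ⟨c, hc, hcS⟩
    have : ∃ p, Multigraph.IsOcc emb.boundary e p := by
      by_contra hno
      push Not at hno
      have := emb.edge_twice e
      rw [show {p : F × ℕ | Multigraph.IsOcc emb.boundary e p} = ∅ by ext p; simpa using hno p] at this
      simp at this
    obtain ⟨⟨f, k⟩, hk, hke⟩ := this
    simp only at hk hke
    have hcomp := (emb.boundary f).compat k
    rw [hke, he] at hcomp
    obtain ⟨k1, hk1⟩ := hcor f k
    obtain ⟨k2, hk2⟩ := hcor f (k+1)
    rcases Sym2.eq_iff.1 hcomp with ⟨h1, h2⟩ | ⟨h1, h2⟩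
    · rw [← h1] at hk1; rw [← h2] at hk2
      exact ⟨_, hk2, (hlink u _ _ (emb.link_conn u _ _ hc hk1)).1 hcS⟩
    · rw [← h1] at hk2; rw [← h2] at hk1
      exact ⟨_, hk1, (hlink u _ _ (emb.link_conn u _ _ hc hk2)).1 hcS⟩
  obtain ⟨f, hf⟩ := hS
  obtain ⟨f', hf'⟩ := hS'
  obtain ⟨k, hk⟩ := hcor f 0
  obtain ⟨k', hk'⟩ := hcor f' 0
  have h0 : P ((emb.boundary f).vtx 0) := ⟨_, hk, hf⟩
  obtain ⟨w⟩ := emb.conn.preconnected ((emb.boundary f).vtx 0) ((emb.boundary f').vtx 0)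
  have hw : ∀ (x y : V) (w : M.simple.Walk x y), P x → P y := by
    intro x y w
    induction w with
    | nil => exact id
    | cons h _ ih => exact fun hx => ih (hstep _ _ h hx)
  obtain ⟨c, hc, hcS⟩ := hw _ _ w h0
  exact hf' ((hlink _ _ _ (emb.link_conn _ _ _ hc hk')).1 hcS)

end GPS


namespace GPS

variable {V E F : Type}

theorem per_sum {β : Type} [AddCommMonoid β] (h : ℕ → β) (d : ℕ) (hp : ∀ i, h (i + d) = h i) (j : ℕ) :
    ∑ k ∈ Finset.range d, h (j + k) = ∑ k ∈ Finset.range d, h k := by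
  induction j with
  | zero => simp
  | succ j ih =>
    rw [← ih]
    cases d with
    | zero => simp
    | succ d =>
      rw [Finset.sum_range_succ, Finset.sum_range_succ' (fun k => h (j + k))]
      congr 1
      · apply Finset.sum_congr rfl; intro k _; congr 1; omega
      · rw [← hp (j + 0)]; congr 1; omega

open Classical in
theorem cut {M : Multigraph V E} (W : M.CWalk) (j : ℕ) (a b : V) (h : M.ends (W.edge j) = s(a, b)) :
    ∃ (d : ℕ) (w : ℕ → V) (u : ℕ → E), w 0 = a ∧ w d = b ∧
      (∀ k, k < d → M.ends (u k) = s(w k, w (k+1))) ∧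
      ∀ e', (∑ k ∈ Finset.range d, if u k = e' then 1 else 0) + (if W.edge j = e' then 1 else 0) = occ W e' := by
  obtain ⟨d, hd⟩ : ∃ d, W.len = d + 1 := ⟨W.len - 1, by have := W.len_pos; omega⟩
  have hv := W.vtx_per
  have he := W.edge_per
  have hocc : ∀ e', (∑ k ∈ Finset.range d, if W.edge (j + 1 + k) = e' then 1 else 0) + (if W.edge j = e' then 1 else 0) = occ W e' := by
    intro e'
    unfold occ
    rw [← per_sum (fun k => if W.edge k = e' then 1 else 0) W.len (fun i => by simp only [he]) (j + 1), hd,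
      Finset.sum_range_succ]
    congr 1
    rw [← he j, hd, show j + 1 + d = j + (d + 1) by ring]
  have hc := W.compat j
  rw [h] at hc
  rcases Sym2.eq_iff.1 hc with ⟨h1, h2⟩ | ⟨h1, h2⟩
  · refine ⟨d, fun k => W.vtx (j + 1 + (d - k)), fun k => W.edge (j + 1 + (d - 1 - k)), ?_, ?_, ?_, ?_⟩
    · rw [h1, ← hv j]; exact congrArg W.vtx (by omega)
    · rw [h2]; exact congrArg W.vtx (by omega)
    · intro k hk
      rw [W.compat, Sym2.eq_swap]
      have a1 : j + 1 + (d - 1 - k) + 1 = j + 1 + (d - k) := by omega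
      have a2 : j + 1 + (d - 1 - k) = j + 1 + (d - (k + 1)) := by omega
      rw [a1, a2]
    · intro e'
      rw [← hocc e']
      congr 1
      exact Finset.sum_range_reflect (fun k => if W.edge (j + 1 + k) = e' then 1 else 0) d
  · refine ⟨d, fun k => W.vtx (j + 1 + k), fun k => W.edge (j + 1 + k), ?_, ?_, ?_, hocc⟩
    · rw [h1]
    · rw [h2, ← hv j]; exact congrArg W.vtx (by omega)
    · intro k hk
      rw [W.compat]; rfl

open Classical in
structure Poly [Fintype F] {M : Multigraph V E} (emb : M.Embedding F) {r : V} (R : RT M r) (S : Finset F) where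
  n : ℕ
  lab : ℕ → V
  side : ℕ → Option E
  N : ℕ → ℕ → Prop
  C : Finset E
  lab0 : lab 0 = r
  sideE : ∀ i, i < n → ∀ e, side i = some e → M.ends e = s(lab i, lab (i+1))
  sideN : ∀ i, i < n → side i = none → lab i = lab (i+1)
  Nlt : ∀ i j, N i j → i < j ∧ j ≤ n
  nc : ∀ i j k l, N i j → N k l → ¬ (i < k ∧ k < j ∧ j < l)
  CT : ∀ e ∈ C, e ∉ R.T
  Ccard : C.card + 1 = S.card
  Cch : ∀ e ∈ C, ∃ i j, N i j ∧ M.ends e = s(lab i, lab j)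
  cnt : ∀ e, (∑ i ∈ Finset.range n, if side i = some e then 1 else 0) + (if e ∈ C then 2 else 0)
    = ∑ f ∈ S, occ (emb.boundary f) e

theorem poly_init [Fintype F] {M : Multigraph V E} (emb : M.Embedding F) (f : F)
    (R : RT M ((emb.boundary f).vtx 0)) : Nonempty (Poly emb R {f}) := by
  classical
  exact ⟨{ n := (emb.boundary f).len
           lab := (emb.boundary f).vtx
           side := fun k => some ((emb.boundary f).edge k)
           N := fun _ _ => False
           C := ∅
           lab0 := rfl
           sideE := by
            intro i _ e he
            simp only [Option.some.injEq] at he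
            rw [← he]; exact (emb.boundary f).compat i
           sideN := by simp
           Nlt := by simp
           nc := by simp
           CT := by simp
           Ccard := by simp
           Cch := by simp
           cnt := by intro e; simp [occ] }⟩

theorem poly_step [Fintype F] [Fintype E] {M : Multigraph V E} (emb : M.Embedding F) {r : V} (R : RT M r)
    (S : Finset F) (P : Poly emb R S) (hS' : ∃ f, f ∉ S) :
    ∃ S' : Finset F, S'.card = S.card + 1 ∧ Nonempty (Poly emb R S') := by
  classical
  have hSn : S.Nonempty := by
    have := P.Ccard
    exact Finset.card_pos.1 (by omega)
  obtain ⟨e, heT, he1⟩ := dual_conn emb R S hSn hS'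
  have hcnt := P.cnt e
  rw [he1] at hcnt
  have heC : e ∉ P.C := by
    intro h; simp [h] at hcnt
  simp only [heC, if_false, add_zero] at hcnt
  obtain ⟨i0, hi0, hi0e⟩ : ∃ i0, i0 < P.n ∧ P.side i0 = some e := by
    by_contra hno
    push Not at hno
    rw [Finset.sum_eq_zero] at hcnt
    · omega
    · intro i hi; simp [hno i (Finset.mem_range.1 hi)]
  obtain ⟨f, hfS, hf⟩ : ∃ f, f ∉ S ∧ 0 < occ (emb.boundary f) e := by
    by_contra hno
    push Not at hno
    have h := occ_total emb e
    rw [← Finset.sum_add_sum_compl S, he1, Finset.sum_eq_zero] at h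
    · omega
    · intro f hf; have := hno f (by simpa using hf); omega
  obtain ⟨j, hj⟩ : ∃ j, (emb.boundary f).edge j = e := by
    by_contra hno
    push Not at hno
    unfold occ at hf
    simp [hno] at hf
  obtain ⟨d, w, u, hw0, hwd, hu, hocc⟩ := cut (emb.boundary f) j (P.lab i0) (P.lab (i0+1))
    (by rw [hj]; exact P.sideE i0 hi0 e hi0e)
  rw [hj] at hocc
  obtain ⟨m, hm⟩ : ∃ m, P.n = i0 + 1 + m := ⟨P.n - i0 - 1, by omega⟩
  let σ : ℕ → ℕ := fun k => if k ≤ i0 then k else k + (d + 1)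
  let lab' : ℕ → V := fun k => if k ≤ i0 then P.lab k else if k ≤ i0 + 1 + d then w (k - i0 - 1) else P.lab (k - (d + 1))
  let side' : ℕ → Option E := fun k => if k < i0 then P.side k else if k = i0 then none else
    if k < i0 + 1 + d then some (u (k - i0 - 1)) else if k = i0 + 1 + d then none else P.side (k - (d + 1))
  have hσlab : ∀ k, lab' (σ k) = P.lab k := by
    intro k
    simp only [lab', σ]
    by_cases hk : k ≤ i0
    · simp [hk]
    · simp only [hk, if_false]
      rw [if_neg (by omega), if_neg (by omega)]
      congr 1; omega
  have hσlt : ∀ k l, σ k < σ l ↔ k < l := by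
    intro k l
    simp only [σ]
    split_ifs <;> omega
  have hσi : σ i0 = i0 := by simp [σ]
  have hσi1 : σ (i0+1) = i0 + 1 + (d + 1) := by simp [σ]
  refine ⟨insert f S, Finset.card_insert_of_notMem hfS, ⟨{
    n := P.n + (d + 1)
    lab := lab'
    side := side'
    N := fun i j => (∃ k l, P.N k l ∧ i = σ k ∧ j = σ l) ∨ (i = σ i0 ∧ j = σ (i0+1))
    C := insert e P.C
    lab0 := by simp [lab', P.lab0]
    sideE := ?_
    sideN := ?_
    Nlt := ?_
    nc := ?_
    CT := ?_
    Ccard := ?_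
    Cch := ?_
    cnt := ?_ }⟩⟩
  · intro k hk e' hke
    simp only [side'] at hke
    rcases lt_trichotomy k i0 with h | h | h
    · rw [if_pos h] at hke
      have := P.sideE k (by omega) e' hke
      simp only [lab']
      rwa [if_pos (by omega), if_pos (by omega)]
    · rw [if_neg (by omega), if_pos h] at hke; simp at hke
    · rw [if_neg (by omega), if_neg (by omega)] at hke
      rcases lt_trichotomy k (i0 + 1 + d) with h' | h' | h'
      · rw [if_pos h'] at hke
        simp only [Option.some.injEq] at hke
        have := hu (k - i0 - 1) (by omega)
        rw [hke] at this
        simp only [lab']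
        rw [if_neg (by omega), if_pos (by omega), if_neg (by omega), if_pos (by omega), this]
        congr 3; omega
      · rw [if_neg (by omega), if_pos h'] at hke; simp at hke
      · rw [if_neg (by omega), if_neg (by omega)] at hke
        have := P.sideE _ (by omega) e' hke
        simp only [lab']
        rw [if_neg (by omega), if_neg (by omega), if_neg (by omega), if_neg (by omega), this]
        congr 3; omega
  · intro k hk hke
    simp only [side'] at hke
    rcases lt_trichotomy k i0 with h | h | h
    · rw [if_pos h] at hke
      have := P.sideN k (by omega) hke
      simp only [lab']
      rwa [if_pos (by omega), if_pos (by omega)]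
    · subst h
      simp only [lab']
      rw [if_pos le_rfl, if_neg (by omega), if_pos (by omega), ← hw0]
      congr 1; omega
    · rw [if_neg (by omega), if_neg (by omega)] at hke
      rcases lt_trichotomy k (i0 + 1 + d) with h' | h' | h'
      · rw [if_pos h'] at hke
        simp at hke
      · subst h'
        simp only [lab']
        rw [if_neg (by omega), if_pos (by omega), if_neg (by omega), if_neg (by omega),
          show i0 + 1 + d - i0 - 1 = d by omega, hwd]
        congr 1; omega
      · rw [if_neg (by omega), if_neg (by omega)] at hke
        have := P.sideN _ (by omega) hke
        simp only [lab']
        rw [if_neg (by omega), if_neg (by omega), if_neg (by omega), if_neg (by omega), this]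
        congr 1; omega
  · rintro i j (⟨k, l, hkl, rfl, rfl⟩ | ⟨rfl, rfl⟩)
    · have := P.Nlt _ _ hkl
      refine ⟨(hσlt _ _).2 this.1, ?_⟩
      simp only [σ]; split_ifs <;> omega
    · refine ⟨(hσlt _ _).2 (by omega), ?_⟩
      rw [hσi1]; omega
  · rintro i j k l (⟨a, b, hab, rfl, rfl⟩ | ⟨rfl, rfl⟩) (⟨a', b', hab', rfl, rfl⟩ | ⟨rfl, rfl⟩)
    · simp only [hσlt]; exact P.nc _ _ _ _ hab hab'
    · simp only [hσlt]; omega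
    · simp only [hσlt]; omega
    · simp only [hσlt]; omega
  · intro e' he'
    rcases Finset.mem_insert.1 he' with rfl | h
    · exact heT
    · exact P.CT _ h
  · rw [Finset.card_insert_of_notMem heC, Finset.card_insert_of_notMem hfS, P.Ccard]
  · intro e' he'
    rcases Finset.mem_insert.1 he' with rfl | h
    · refine ⟨_, _, Or.inr ⟨rfl, rfl⟩, ?_⟩
      rw [hσlab, hσlab]; exact P.sideE i0 hi0 _ hi0e
    · obtain ⟨i, j, hij, hh⟩ := P.Cch _ h
      refine ⟨σ i, σ j, Or.inl ⟨i, j, hij, rfl, rfl⟩, ?_⟩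
      rw [hσlab, hσlab]; exact hh
  · intro e'
    rw [Finset.sum_insert hfS, ← P.cnt e', ← hocc e', hm,
      show i0 + 1 + m + (d + 1) = i0 + (1 + (d + (1 + m))) by ring]
    simp only [Finset.sum_range_add, Finset.sum_range_one]
    have s1 : ∑ x ∈ Finset.range i0, (if side' x = some e' then 1 else 0) =
        ∑ x ∈ Finset.range i0, (if P.side x = some e' then 1 else 0) := by
      apply Finset.sum_congr rfl; intro x hx
      have := Finset.mem_range.1 hx
      simp [side', this]
    have s2 : ∑ x ∈ Finset.range d, (if side' (i0 + (1 + x)) = some e' then 1 else 0) =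
        ∑ x ∈ Finset.range d, (if u x = e' then 1 else 0) := by
      apply Finset.sum_congr rfl; intro x hx
      have := Finset.mem_range.1 hx
      have h3 : side' (i0 + (1 + x)) = some (u x) := by
        simp only [side']
        rw [if_neg (by omega), if_neg (by omega), if_pos (by omega)]
        congr 2; omega
      rw [h3]; simp
    have s3 : ∑ x ∈ Finset.range m, (if side' (i0 + (1 + (d + (1 + x)))) = some e' then 1 else 0) =
        ∑ x ∈ Finset.range m, (if P.side (i0 + 1 + x) = some e' then 1 else 0) := by
      apply Finset.sum_congr rfl; intro x hx
      have := Finset.mem_range.1 hx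
      have h3 : side' (i0 + (1 + (d + (1 + x)))) = P.side (i0 + 1 + x) := by
        simp only [side']
        rw [if_neg (by omega), if_neg (by omega), if_neg (by omega), if_neg (by omega)]
        congr 1; omega
      rw [h3]
    have s4 : side' (i0 + 0) = none := by simp [side']
    have s5 : side' (i0 + (1 + (d + 0))) = none := by
      simp only [side']
      rw [if_neg (by omega), if_neg (by omega), if_neg (by omega), if_pos (by omega)]
    rw [s1, s2, s3, s4, s5]
    simp only [add_zero, hi0e, Option.some.injEq, reduceCtorEq, if_false, zero_add, Finset.mem_insert]
    by_cases hee : e' = e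
    · subst hee; simp [heC]; ring
    · have : ¬ e = e' := fun h => hee h.symm
      simp [hee, this]; ring

theorem poly_full [Fintype F] [Fintype E] {M : Multigraph V E} (emb : M.Embedding F) (f : F)
    (R : RT M ((emb.boundary f).vtx 0)) : Nonempty (Poly emb R Finset.univ) := by
  classical
  have key : ∀ k, k + 1 ≤ Fintype.card F → ∃ S : Finset F, S.card = k + 1 ∧ Nonempty (Poly emb R S) := by
    intro k
    induction k with
    | zero => intro _; exact ⟨{f}, by simp, poly_init emb f R⟩
    | succ k ih =>
      intro hk
      obtain ⟨S, hS, ⟨P⟩⟩ := ih (by omega)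
      have : ∃ f, f ∉ S := by
        by_contra hno
        push Not at hno
        have : S = Finset.univ := by ext; simp [hno]
        rw [this, Finset.card_univ] at hS
        omega
      obtain ⟨S', h1, h2⟩ := poly_step emb R S P this
      exact ⟨S', by omega, h2⟩
  have hc : 0 < Fintype.card F := Fintype.card_pos_iff.2 ⟨f⟩
  obtain ⟨S, h1, h2⟩ := key (Fintype.card F - 1) (by omega)
  have : S = Finset.univ := by
    rw [← Finset.card_eq_iff_eq_univ]; omega
  rwa [this] at h2

end GPS


namespace GPS

variable {V E F : Type}

theorem exists_flip (h : ℕ → Prop) (a b : ℕ) (hab : a ≤ b) (hne : ¬ (h a ↔ h b)) :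
    ∃ c, a ≤ c ∧ c < b ∧ ¬ (h c ↔ h (c+1)) := by
  induction b, hab using Nat.le_induction with
  | base => exact absurd Iff.rfl hne
  | succ b hab ih =>
    by_cases h1 : h a ↔ h b
    · exact ⟨b, hab, by omega, fun h2 => hne (h1.trans h2)⟩
    · obtain ⟨c, c1, c2, c3⟩ := ih h1
      exact ⟨c, c1, by omega, c3⟩

theorem ctx_exists [Fintype F] {M : Multigraph V E} {emb : M.Embedding F} {r : V} {R : RT M r}
    (P : Poly emb R Finset.univ) (Z : Set V) (hr : r ∈ Z)
    (hZ : ∀ e, e ∉ R.T → e ∉ P.C → ∀ x ∈ M.ends e, ∀ v, R.A x v → v ∈ Z) :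
    ∃ C : Ctx V, C.G = M.simple ∧ C.A = R.A ∧ C.Z = Z := by
  classical
  have hcnt : ∀ e, (∑ i ∈ Finset.range P.n, if P.side i = some e then 1 else 0) + (if e ∈ P.C then 2 else 0) = 2 :=
    fun e => (P.cnt e).trans (occ_total emb e)
  let N' : ℕ → ℕ → Prop := fun i j => P.N i j ∨ (j = i + 1 ∧ j ≤ P.n)
  have hN' : ∀ i j, N' i j → i < j ∧ j ≤ P.n := by
    rintro i j (h | ⟨h1, h2⟩)
    · exact P.Nlt _ _ h
    · omega
  have hnc : ∀ i j k l, N' i j → N' k l → ¬ (i < k ∧ k < j ∧ j < l) := by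
    rintro i j k l (h | ⟨h1, h2⟩) (h' | ⟨h1', h2'⟩)
    · exact P.nc _ _ _ _ h h'
    all_goals omega
  have hedge : ∀ e, ∃ i j, N' i j ∧ M.ends e = s(P.lab i, P.lab j) := by
    intro e
    by_cases he : e ∈ P.C
    · obtain ⟨i, j, h1, h2⟩ := P.Cch e he
      exact ⟨i, j, Or.inl h1, h2⟩
    · have h := hcnt e
      simp only [he, if_false, add_zero] at h
      obtain ⟨i, hi, hie⟩ : ∃ i, i < P.n ∧ P.side i = some e := by
        by_contra hno
        push Not at hno
        rw [Finset.sum_eq_zero] at h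
        · omega
        · intro i hi; simp [hno i (Finset.mem_range.1 hi)]
      exact ⟨i, i + 1, Or.inr ⟨rfl, hi⟩, P.sideE i hi e hie⟩
  have hsurj : ∀ v, ∃ i, i ≤ P.n ∧ P.lab i = v := by
    intro v
    by_cases hv : v = r
    · exact ⟨0, Nat.zero_le _, by rw [hv, P.lab0]⟩
    · obtain ⟨i, j, h1, h2⟩ := hedge (R.te v)
      have h3 := hN' _ _ h1
      rw [R.tend v hv] at h2
      rcases Sym2.eq_iff.1 h2 with ⟨h, _⟩ | ⟨h, _⟩
      · exact ⟨i, by omega, h.symm⟩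
      · exact ⟨j, by omega, h.symm⟩
  have hflip : ∀ v, v ∉ Z → ∀ i, i < P.n → ¬ (R.A (P.lab i) v ↔ R.A (P.lab (i+1)) v) →
      P.side i = some (R.te v) := by
    intro v hv i hi hne
    cases hs : P.side i with
    | none => exact absurd (by rw [P.sideN i hi hs]) hne
    | some e =>
      have hends := P.sideE i hi e hs
      by_cases heT : e ∈ R.T
      · obtain ⟨w, hw, rfl⟩ := heT
        by_cases hwv : w = v
        · rw [hwv]
        · exact absurd (R.flip w v _ _ hw hwv hends) hne
      · have heC : e ∉ P.C := by
          intro h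
          have := hcnt e
          simp only [h, if_true] at this
          have h0 : 0 < ∑ i ∈ Finset.range P.n, if P.side i = some e then 1 else 0 :=
            Finset.sum_pos' (fun _ _ => Nat.zero_le _) ⟨i, Finset.mem_range.2 hi, by simp [hs]⟩
          omega
        exfalso
        apply hne
        have a1 := fun h => hv (hZ e heT heC (P.lab i) (by rw [hends]; simp) v h)
        have a2 := fun h => hv (hZ e heT heC (P.lab (i+1)) (by rw [hends]; simp) v h)
        exact ⟨fun h => (a1 h).elim, fun h => (a2 h).elim⟩
  have hconv : ∀ v, v ∉ Z → ∀ i j k, i < j → j < k → k ≤ P.n → R.A (P.lab i) v → R.A (P.lab k) v →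
      R.A (P.lab j) v := by
    intro v hv i j k hij hjk hk hi hkA
    by_contra hj
    have h0 : ¬ R.A (P.lab 0) v := by
      rw [P.lab0]; intro h; exact hv (by rw [R.A_root v h]; exact hr)
    let h : ℕ → Prop := fun i => R.A (P.lab i) v
    obtain ⟨c1, a1, b1, f1⟩ := exists_flip h 0 i (Nat.zero_le _) (fun hh => h0 (hh.2 hi))
    obtain ⟨c2, a2, b2, f2⟩ := exists_flip h i j hij.le (fun hh => hj (hh.1 hi))
    obtain ⟨c3, a3, b3, f3⟩ := exists_flip h j k hjk.le (fun hh => hj (hh.2 hkA))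
    have g1 := hflip v hv c1 (by omega) f1
    have g2 := hflip v hv c2 (by omega) f2
    have g3 := hflip v hv c3 (by omega) f3
    have hc := hcnt (R.te v)
    have hsub : ({c1, c2, c3} : Finset ℕ) ⊆ (Finset.range P.n).filter (fun i => P.side i = some (R.te v)) := by
      intro x hx
      simp only [Finset.mem_insert, Finset.mem_singleton] at hx
      simp only [Finset.mem_filter, Finset.mem_range]
      rcases hx with rfl | rfl | rfl
      · exact ⟨by omega, g1⟩
      · exact ⟨by omega, g2⟩
      · exact ⟨by omega, g3⟩
    have := Finset.card_le_card hsub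
    rw [Finset.card_filter, Finset.card_eq_three.2 ⟨c1, c2, c3, by omega, by omega, by omega, rfl⟩] at this
    omega
  refine ⟨{
    G := M.simple
    A := R.A
    Arefl := R.A_refl
    Atrans := fun u v w => R.A_trans
    Z := Z
    Pos := (Finset.range (P.n + 1)).image (fun i : ℕ => (i : ℚ))
    lab := fun q => P.lab ⌊q⌋₊
    N := fun q s => ∃ i j : ℕ, q = i ∧ s = j ∧ N' i j
    Nlt := ?_
    NP := ?_
    nc := ?_
    adj := ?_
    surj := ?_
    conv := ?_
    consec := ?_
    hZ := ?_ }, rfl, rfl, rfl⟩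
  · rintro _ _ ⟨i, j, rfl, rfl, h⟩
    exact_mod_cast (hN' _ _ h).1
  · rintro _ _ ⟨i, j, rfl, rfl, h⟩
    have := hN' _ _ h
    simp only [Finset.mem_image, Finset.mem_range, Nat.cast_inj, exists_eq_right]
    omega
  · rintro _ _ _ _ ⟨i, j, rfl, rfl, h⟩ ⟨k, l, rfl, rfl, h'⟩
    have := hnc _ _ _ _ h h'
    exact_mod_cast this
  · rintro u w ⟨_, e, he⟩
    obtain ⟨i, j, h1, h2⟩ := hedge e
    rw [he] at h2
    rcases Sym2.eq_iff.1 h2 with ⟨h, h'⟩ | ⟨h, h'⟩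
    · exact ⟨i, j, Or.inl ⟨i, j, rfl, rfl, h1⟩, by simp [h], by simp [h']⟩
    · exact ⟨j, i, Or.inr ⟨i, j, rfl, rfl, h1⟩, by simp [h], by simp [h']⟩
  · intro v
    obtain ⟨i, hi, h⟩ := hsurj v
    exact ⟨i, Finset.mem_image.2 ⟨i, Finset.mem_range.2 (by omega), rfl⟩, by simp [h]⟩
  · intro v hv i j k hi hj hk hij hjk
    obtain ⟨i, hi', rfl⟩ := Finset.mem_image.1 hi
    obtain ⟨j, hj', rfl⟩ := Finset.mem_image.1 hj
    obtain ⟨k, hk', rfl⟩ := Finset.mem_image.1 hk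
    have := Finset.mem_range.1 hk'
    simp only [Nat.floor_natCast]
    exact hconv v hv i j k (by exact_mod_cast hij) (by exact_mod_cast hjk) (by omega)
  · intro i k hi hk hik hno
    obtain ⟨i, hi', rfl⟩ := Finset.mem_image.1 hi
    obtain ⟨k, hk', rfl⟩ := Finset.mem_image.1 hk
    have h1 := Finset.mem_range.1 hk'
    have h2 : i < k := by exact_mod_cast hik
    refine ⟨i, k, rfl, rfl, Or.inr ⟨?_, by omega⟩⟩
    by_contra hne
    refine hno ((i + 1 : ℕ) : ℚ) (Finset.mem_image.2 ⟨i+1, Finset.mem_range.2 (by omega), rfl⟩) ⟨?_, ?_⟩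
    · exact_mod_cast Nat.lt_succ_self i
    · exact_mod_cast (by omega : i + 1 < k)
  · exact ⟨0, Finset.mem_image.2 ⟨0, by simp, by simp⟩, by simpa [P.lab0] using hr⟩

theorem cover (K : ℕ) (Y : Finset V) (hY : Y.card ≤ K) (r : V) : ∃ a : Fin K → V, ∀ y ∈ Y, ∃ i, a i = y := by
  classical
  refine ⟨fun i => if h : i.1 < Y.card then (Y.equivFin.symm ⟨i.1, h⟩).1 else r, ?_⟩
  intro y hy
  refine ⟨⟨(Y.equivFin ⟨y, hy⟩).1, (Y.equivFin ⟨y, hy⟩).2.trans_le hY⟩, ?_⟩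
  simp

theorem init_sol [Finite V] (C : Ctx V) (hdesc : ∀ x v, C.A x v → x ∈ C.Z → v ∈ C.Z) :
    Sol C [] (C.Zᶜ) (fun _ => Sum.inl 0) := by
  obtain ⟨B, hB⟩ : ∃ B : ℚ, ∀ t ∈ C.Pos, t < B := by
    by_cases h : C.Pos.Nonempty
    · refine ⟨C.Pos.max' h + 1, fun t ht => ?_⟩
      have := C.Pos.le_max' t ht
      linarith
    · rw [Finset.not_nonempty_iff_eq_empty] at h
      exact ⟨0, by simp [h]⟩
  refine solve (C := C) _ (x1 := B) (x2 := B + 1) (x3 := B + 2) (π := id) rfl ?_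
  refine ⟨fun v hv => hv, ?_, by linarith, by linarith, ?_, ?_, ?_, Function.injective_id, ?_, ?_, ?_, ?_⟩
  · intro v hv x hx hxZ
    exact hv (hdesc x v hx hxZ)
  · intro h; have := hB _ h; linarith
  · intro h; have := hB _ h; linarith
  · intro h; have := hB _ h; linarith
  · intro i j hij _ _
    have : j ∈ C.Pos := by
      rcases hij with h | h
      · exact (C.NP _ _ h).2
      · exact (C.NP _ _ h).1
    rw [bi0 (hB _ this)]; rfl
  · intro v _ s t _ ht _; exact hB _ ht.1
  · intro v _ s t _ ht _; have := hB _ ht.1; linarith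
  · intro v _ s t _ ht _; have := hB _ ht.1; linarith

theorem main_nonempty [Fintype V] [Fintype E] [Fintype F] {M : Multigraph V E} (emb : M.Embedding F)
    (g : ℕ) (hg : emb.eulerGenus ≤ g) (f : F) :
    ∃ (n0 n : ℕ), M.simple.IsContainedIn (((HG n0).strongProd (SimpleGraph.pathGraph n)).strongProd
          (SimpleGraph.completeGraph (Fin (max (2 * g) 3)))) := by
  classical
  obtain ⟨r, R, ⟨P⟩⟩ : ∃ (r : V) (R : RT M r), Nonempty (Poly emb R Finset.univ) := by
    obtain ⟨R⟩ := rt_exists M ((emb.boundary f).vtx 0) emb.conn ((emb.boundary f).edge 0)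
    exact ⟨_, R, poly_full emb f R⟩
  set K := max (2 * g) 3 with hK
  let TF : Finset E := (Finset.univ.erase r).image R.te
  have hTF : ∀ e, e ∈ TF ↔ e ∈ R.T := by
    intro e; simp [TF, RT.T]
  have hTcard : TF.card = Fintype.card V - 1 := by
    rw [Finset.card_image_of_injOn, Finset.card_erase_of_mem (Finset.mem_univ _), Finset.card_univ]
    intro v hv w hw h
    exact R.te_inj v w (by simpa using hv) (by simpa using hw) h
  let X : Finset E := (TF ∪ P.C)ᶜ
  have hdis : Disjoint TF P.C := by
    rw [Finset.disjoint_left]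
    intro e he heC
    exact P.CT e heC ((hTF e).1 he)
  have hX : X.card ≤ g := by
    have h1 : X.card = Fintype.card E - (TF ∪ P.C).card := Finset.card_compl _
    have h2 := Finset.card_le_univ (TF ∪ P.C)
    rw [Finset.card_union_of_disjoint hdis, hTcard] at h1 h2
    have h3 := P.Ccard
    rw [Finset.card_univ] at h3
    have h4 : 0 < Fintype.card V := Fintype.card_pos_iff.2 ⟨r⟩
    unfold Multigraph.Embedding.eulerGenus at hg
    simp only [Nat.card_eq_fintype_card] at hg
    omega
  have hends : ∀ e, ∃ x y, M.ends e = s(x, y) := fun e => by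
    induction h : M.ends e using Sym2.ind with
    | _ x y => exact ⟨x, y, rfl⟩
  choose x y hxy using hends
  obtain ⟨a, ha⟩ := cover K (X.image x ∪ X.image y) (by
    have h1 := Finset.card_union_le (X.image x) (X.image y)
    have h2 := Finset.card_image_le (s := X) (f := x)
    have h3 := Finset.card_image_le (s := X) (f := y)
    omega) r
  let Z : Set V := {v | ∃ i, R.A (a i) v}
  obtain ⟨C, hCG, hCA, hCZ⟩ := ctx_exists P Z ⟨⟨0, by omega⟩, R.A_to_root _⟩ (by
    intro e heT heC z hz v hv
    have heX : e ∈ X := by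
      simp only [X, Finset.mem_compl, Finset.mem_union, hTF]
      tauto
    have : z ∈ X.image x ∪ X.image y := by
      rw [hxy e] at hz
      rcases Sym2.mem_iff.1 hz with rfl | rfl
      · exact Finset.mem_union_left _ (Finset.mem_image_of_mem _ heX)
      · exact Finset.mem_union_right _ (Finset.mem_image_of_mem _ heX)
    obtain ⟨i, rfl⟩ := ha z this
    exact ⟨i, hv⟩)
  obtain ⟨φ, h1, h2, h3, h4⟩ := init_sol C (by
    intro x v hxv hx
    rw [hCZ] at hx ⊢
    rw [hCA] at hxv
    obtain ⟨i, hi⟩ := hx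
    exact ⟨i, R.A_trans hi hxv⟩)
  rw [hCA] at h4
  rw [hCG] at h3
  simp only [hCZ, Set.mem_compl_iff, not_not] at h1 h2 h3 h4
  choose b hb using h4
  -- bounds
  obtain ⟨n0, hn0⟩ : ∃ n0, ∀ v, ok n0 (φ v) := by
    let len : W → ℕ := fun w => match w with
      | Sum.inl _ => 0
      | Sum.inr α => α.length + 1
    refine ⟨Finset.univ.sup (fun v => len (φ v)), fun v => ?_⟩
    have := Finset.le_sup (f := fun v => len (φ v)) (Finset.mem_univ v)
    cases h : φ v with
    | inl i => trivial
    | inr α =>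
      simp only [h, len] at this
      exact this
  obtain ⟨n, hn⟩ : ∃ n, ∀ v, R.dep v < n := by
    refine ⟨Finset.univ.sup R.dep + 1, fun v => ?_⟩
    have := Finset.le_sup (f := R.dep) (Finset.mem_univ v)
    omega
  have hidx : ∀ v, ∃ i : Fin K, (v ∈ Z → R.A (a i) v) ∧
      (v ∉ Z → ∃ (β : List (Fin 3)) (j : Fin 3), φ v = Sum.inr β ∧ i.1 = j.1 ∧ R.A (b β j) v) := by
    intro v
    by_cases hv : v ∈ Z
    · obtain ⟨i, hi⟩ := hv
      exact ⟨i, fun _ => hi, fun h => absurd ⟨i, hi⟩ h⟩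
    · obtain ⟨β, hβ, -⟩ := h2 v hv
      obtain ⟨j, hj⟩ := hb β v hv hβ
      exact ⟨⟨j.1, by have := j.2; omega⟩, fun h => absurd h hv, fun _ => ⟨β, j, hβ, rfl, hj⟩⟩
  choose idx hi1 hi2 using hidx
  let Φ : V → (({w : W // ok n0 w} × Fin n) × Fin K) := fun v => ((⟨φ v, hn0 v⟩, ⟨R.dep v, hn v⟩), idx v)
  have hinj : Function.Injective Φ := by
    intro u v huv
    simp only [Φ, Prod.mk.injEq, Subtype.mk.injEq, Fin.mk.injEq] at huv
    obtain ⟨⟨e1, e2⟩, e3⟩ := huv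
    by_cases hu : u ∈ Z <;> by_cases hv : v ∈ Z
    · have a1 := hi1 u hu
      have a2 := hi1 v hv
      rw [e3] at a1
      exact R.A_dep _ _ _ a1 a2 e2
    · obtain ⟨β, hβ, -⟩ := h2 v hv
      rw [h1 u hu, hβ] at e1
      cases e1
    · obtain ⟨β, hβ, -⟩ := h2 u hu
      rw [h1 v hv, hβ] at e1
      cases e1
    · obtain ⟨β, j, p1, p2, p3⟩ := hi2 u hu
      obtain ⟨β', j', q1, q2, q3⟩ := hi2 v hv
      rw [p1, q1] at e1
      cases e1
      have : j = j' := Fin.ext (by rw [← p2, ← q2, e3])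
      subst this
      exact R.A_dep _ _ _ p3 q3 e2
  refine ⟨n0, n, ⟨Φ, ?_⟩, hinj⟩
  intro u v huv
  have hne : Φ u ≠ Φ v := fun h => huv.ne (hinj h)
  refine ⟨hne, ?_, ?_⟩
  · by_cases hp : (Φ u).1 = (Φ v).1
    · exact Or.inl hp
    · refine Or.inr ⟨hp, ?_, ?_⟩
      · have : φ u = φ v ∨ HR (φ u) (φ v) := by
          by_cases hu : u ∈ Z
          · by_cases hv : v ∈ Z
            · left; rw [h1 u hu, h1 v hv]
            · exact (h3 v hv u huv.symm).imp Eq.symm HR.symm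
          · exact h3 u hu v huv
        by_cases hφ : φ u = φ v
        · exact Or.inl (Subtype.ext hφ)
        · exact Or.inr ⟨fun h => hφ (congrArg Subtype.val h), this.resolve_left hφ⟩
      · have d1 := R.dedge u v huv
        have d2 := R.dedge v u huv.symm
        simp only [Φ, SimpleGraph.pathGraph_adj, Fin.mk.injEq]
        omega
  · by_cases hi : idx u = idx v
    · exact Or.inl hi
    · exact Or.inr hi

theorem main (V : Type) (g : ℕ) (G : SimpleGraph V) (hG : HasEulerGenusLE G g) :
    ∃ (n0 n : ℕ), G.IsContainedIn (((HG n0).strongProd (SimpleGraph.pathGraph n)).strongProd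
          (SimpleGraph.completeGraph (Fin (max (2 * g) 3)))) := by
  classical
  obtain ⟨V', E', F', hV, hE, hF, M, emb, hg, ι, hι⟩ := hG
  have := Fintype.ofFinite V'
  have := Fintype.ofFinite E'
  have := Fintype.ofFinite F'
  by_cases hne : Nonempty F'
  · obtain ⟨f⟩ := hne
    obtain ⟨n0, n, φ, hφ⟩ := main_nonempty emb g hg f
    exact ⟨n0, n, φ.comp ι, hφ.comp hι⟩
  · have hF0 : IsEmpty F' := not_nonempty_iff.1 hne
    have hE0 : ∀ e : E', False := by
      intro e
      have := occ_total emb e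
      simp at this
    have hV0 : ∀ u v : V', u = v := by
      intro u v
      obtain ⟨w⟩ := emb.conn.preconnected u v
      cases w with
      | nil => rfl
      | cons h _ => exact (hE0 h.2.choose).elim
    refine ⟨1, 1, ⟨fun _ => ((⟨Sum.inl 0, trivial⟩, 0), ⟨0, by omega⟩), ?_⟩, ?_⟩
    · intro u v huv
      exact (huv.ne (hι (hV0 _ _))).elim
    · intro u v _
      exact hι (hV0 _ _)

end GPS

/-- For every integer `g ≥ 0`, every graph with Euler genus `g` is contained in
`H ⊠ P ⊠ K_{max{2g,3}}` for some apex graph `H` with treewidth at most 4 and for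
some path `P`. -/
theorem genus_product_structure_apex {V : Type} (g : ℕ) (G : SimpleGraph V)
    (hG : HasEulerGenusLE G g) :
    ∃ (W : Type) (H : SimpleGraph W) (n : ℕ),
      IsApex H ∧ TreewidthLE H 4 ∧
      G.IsContainedIn
        ((H.strongProd (SimpleGraph.pathGraph n)).strongProd
          (SimpleGraph.completeGraph (Fin (max (2 * g) 3)))) := by
  obtain ⟨n0, n, h⟩ := GPS.main V g G hG
  exact ⟨_, GPS.HG n0, n, GPS.apex_HG n0, GPS.tw_HG n0, h⟩
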